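/- arXiv:2402.02451 — 4 statements merged into one kernel-verified Lean document; each statement's English description precedes it below -/
import Mathlib

section
/- Let f : ℝ³ → ℝ be smooth and axisymmetric, let n ∈ ℕ and ι₁,…,ιₙ ∈ {r,θ,z}. If the number of indices i with ι_i = θ is odd, then for every x ∈ U: ∇ⁿf(x)[e_{ι₁}(x),…,e_{ιₙ}(x)] = 0. -/
open MeasureTheory

noncomputable section

abbrev R3 : Type := Fin 3 → ℝ

/-- cylindrical radius `r(x) = √(x₁² + x₂²)` -/
def rr (x : R3) : ℝ := Real.sqrt (x 0 ^ 2 + x 1 ^ 2)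

/-- the region off the symmetry axis -/
def U : Set R3 := {x | 0 < rr x}

/-- partial derivative in coordinate direction `i` -/
def pd (i : Fin 3) (u : R3 → ℝ) : R3 → ℝ := fun x => fderiv ℝ u x (Pi.single i 1)

/-- angular derivative `∂_θ u = x₁ ∂₂ u − x₂ ∂₁ u` -/
def dTheta (u : R3 → ℝ) : R3 → ℝ := fun x => x 0 * pd 1 u x - x 1 * pd 0 u x

/-- radial derivative `∂_r u = (x₁ ∂₁ u + x₂ ∂₂ u)/r` -/
def dR (u : R3 → ℝ) : R3 → ℝ := fun x => (x 0 * pd 0 u x + x 1 * pd 1 u x) / rr x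

/-- vertical derivative `∂_z` -/
def dZ (u : R3 → ℝ) : R3 → ℝ := pd 2 u

/-- the operator `(1/r)∂_r` -/
def dRr (u : R3 → ℝ) : R3 → ℝ := fun x => dR u x / rr x

/-- axisymmetric: `∂_θ f = 0` on `U` -/
def axisym (f : R3 → ℝ) : Prop := ∀ x ∈ U, dTheta f x = 0

/-- radial unit vector -/
def er (x : R3) : R3 := ![x 0 / rr x, x 1 / rr x, 0]
/-- azimuthal unit vector -/
def etheta (x : R3) : R3 := ![-(x 1) / rr x, x 0 / rr x, 0]
/-- vertical unit vector -/
def ez : R3 := ![0, 0, 1]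

/-- the cylindrical frame: index `0 ↦ e_r`, `1 ↦ e_θ`, `2 ↦ e_z` -/
def frame (x : R3) : Fin 3 → R3 := ![er x, etheta x, ez]

lemma rot_inv (f : R3 → ℝ) (hf : ContDiff ℝ (⊤ : ℕ∞) f) (hax : axisym f) (r z t : ℝ) :
    f ![r * Real.cos t, r * Real.sin t, z] = f ![r, 0, z] := by
  have hd : Differentiable ℝ f := hf.differentiable (by simp)
  have key : ∀ y : R3, dTheta f y = 0 := by
    intro y
    by_cases hy : y ∈ U
    · exact hax y hy
    · have h0 : y 0 ^ 2 + y 1 ^ 2 ≤ 0 := by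
        by_contra h
        exact hy (Real.sqrt_pos.2 (not_le.1 h))
      have h1 : y 0 = 0 := by nlinarith [sq_nonneg (y 0), sq_nonneg (y 1)]
      have h2 : y 1 = 0 := by nlinarith [sq_nonneg (y 0), sq_nonneg (y 1)]
      simp [dTheta, h1, h2]
  have hder : ∀ s : ℝ, HasDerivAt (fun s => f ![r * Real.cos s, r * Real.sin s, z]) 0 s := by
    intro s
    have hc : HasDerivAt (fun s : ℝ => (![r * Real.cos s, r * Real.sin s, z] : R3))
        (![-(r * Real.sin s), r * Real.cos s, 0] : R3) s := by
      rw [hasDerivAt_pi]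
      intro i
      fin_cases i
      · simpa using (Real.hasDerivAt_cos s).const_mul r
      · simpa using (Real.hasDerivAt_sin s).const_mul r
      · simpa using hasDerivAt_const s z
    have h := (hd ![r * Real.cos s, r * Real.sin s, z]).hasFDerivAt.comp_hasDerivAt s hc
    have hv : (![-(r * Real.sin s), r * Real.cos s, 0] : R3)
        = (r * Real.cos s) • (Pi.single 1 1 : R3) - (r * Real.sin s) • (Pi.single 0 1 : R3) := by
      ext i
      fin_cases i <;> simp
    have hk := key ![r * Real.cos s, r * Real.sin s, z]
    rw [hv, map_sub, map_smul, map_smul] at h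
    simp only [dTheta, pd, Matrix.cons_val_zero, Matrix.cons_val_one] at hk
    simp only [smul_eq_mul] at h
    rw [hk] at h
    exact h
  have := is_const_of_deriv_eq_zero (fun s => (hder s).differentiableAt)
    (fun s => (hder s).deriv) t 0
  simpa using this

lemma f_eq (f : R3 → ℝ) (hf : ContDiff ℝ (⊤ : ℕ∞) f) (hax : axisym f) (y : R3) :
    f y = f ![rr y, 0, y 2] := by
  have hn : ‖(⟨y 0, y 1⟩ : ℂ)‖ = rr y := by
    rw [Complex.norm_def, Complex.normSq_mk, rr]
    congr 1
    ring
  have hc := Complex.norm_mul_cos_arg ⟨y 0, y 1⟩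
  have hs := Complex.norm_mul_sin_arg ⟨y 0, y 1⟩
  rw [hn] at hc hs
  rw [← rot_inv f hf hax (rr y) (y 2) (Complex.arg ⟨y 0, y 1⟩), hc, hs]
  congr 1
  ext i
  fin_cases i <;> simp

/-- reflection in the plane spanned by `(a, b, 0)` and `e_z` -/
def refl3 (a b : ℝ) : R3 →L[ℝ] R3 :=
  LinearMap.toContinuousLinearMap
    (Matrix.toLin' !![2 * a ^ 2 - 1, 2 * a * b, 0; 2 * a * b, 2 * b ^ 2 - 1, 0; 0, 0, 1])

lemma refl3_apply (a b : ℝ) (y : R3) : refl3 a b y =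
    ![(2 * a ^ 2 - 1) * y 0 + 2 * a * b * y 1, 2 * a * b * y 0 + (2 * b ^ 2 - 1) * y 1, y 2] := by
  ext i
  fin_cases i <;> simp [refl3, Matrix.mulVec, dotProduct, Fin.sum_univ_three]

lemma refl3_inv (f : R3 → ℝ) (hf : ContDiff ℝ (⊤ : ℕ∞) f) (hax : axisym f) (a b : ℝ)
    (hab : a ^ 2 + b ^ 2 = 1) : f ∘ refl3 a b = f := by
  ext y
  have h : rr (refl3 a b y) = rr y := by
    rw [rr, rr, refl3_apply]
    congr 1
    simp only [Matrix.cons_val_zero, Matrix.cons_val_one]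
    have hb : b ^ 2 = 1 - a ^ 2 := by linarith
    linear_combination (4 * (a * y 0 + b * y 1) ^ 2) * hab
  rw [Function.comp_apply, f_eq f hf hax, f_eq f hf hax y, h]
  simp [refl3_apply]

/-- a component of the derivative tensor of a smooth axisymmetric
function with an odd number of `e_θ` entries vanishes on `U`. -/
theorem stmt_3 (f : R3 → ℝ) (hf : ContDiff ℝ (⊤ : ℕ∞) f) (hax : axisym f)
    (n : ℕ) (ι : Fin n → Fin 3)
    (hodd : Odd (Finset.univ.filter (fun i => ι i = 1)).card)
    (x : R3) (hx : x ∈ U) :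
    iteratedFDeriv ℝ n f x (fun i => frame x (ι i)) = 0 := by
  have hr : 0 < rr x := hx
  have hr2 : rr x ^ 2 = x 0 ^ 2 + x 1 ^ 2 := Real.sq_sqrt (by positivity)
  obtain ⟨a, ha⟩ : ∃ a, a = x 0 / rr x := ⟨_, rfl⟩
  obtain ⟨b, hb⟩ : ∃ b, b = x 1 / rr x := ⟨_, rfl⟩
  have hxa : x 0 = rr x * a := by rw [ha]; field_simp
  have hxb : x 1 = rr x * b := by rw [hb]; field_simp
  have hab : a ^ 2 + b ^ 2 = 1 := by
    rw [ha, hb, div_pow, div_pow, ← add_div, ← hr2]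
    exact div_self (by positivity)
  have hSx : refl3 a b x = x := by
    rw [refl3_apply]
    ext i
    fin_cases i
    · simp only [Fin.zero_eta, Matrix.cons_val_zero]
      rw [hxa, hxb]
      linear_combination (2 * a * rr x) * hab
    · simp only [Fin.mk_one, Matrix.cons_val_one, Matrix.cons_val_zero]
      rw [hxa, hxb]
      linear_combination (2 * b * rr x) * hab
    · simp
  have hfr : ∀ j : Fin 3, refl3 a b (frame x j)
      = (if j = 1 then (-1 : ℝ) else 1) • frame x j := by
    intro j
    rw [refl3_apply]
    have he : etheta x = ![-b, a, 0] := by rw [etheta, ha, hb, neg_div]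
    have he' : er x = ![a, b, 0] := by rw [er, ha, hb]
    ext i
    fin_cases j <;> fin_cases i <;> simp [frame, he, he', ez]
    · linear_combination (2 * a) * hab
    · linear_combination (2 * b) * hab
    · ring
    · ring
  have h := (refl3 a b).iteratedFDeriv_comp_right hf x (i := n)
    (by exact_mod_cast le_top)
  rw [refl3_inv f hf hax a b hab, hSx] at h
  have h2 := congrArg (fun T => T (fun i => frame x (ι i))) h
  simp only [ContinuousMultilinearMap.compContinuousLinearMap_apply, hfr] at h2
  rw [ContinuousMultilinearMap.map_smul_univ, Finset.prod_ite, Finset.prod_const,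
    Finset.prod_const_one, hodd.neg_one_pow, mul_one, smul_eq_mul] at h2
  linarith
end
end

section
/- Let f : ℝ³ → ℝ be smooth and axisymmetric, and let 𝔐=(m_c,m_r,m_z) be a triple of nonnegative integers with |𝔐| = 2m_c+m_r+m_z = m. Then for every x ∈ U, the m-th derivative of f evaluated at e_θ(x) repeated 2m_c times, e_r(x) repeated m_r times, and e_z repeated m_z times equals (2m_c−1)!! · (𝒟^𝔐 f)(x); that is, ∇^m f(x)[e_θ,…,e_θ,e_r,…,e_r,e_z,…,e_z] = (2m_c−1)!! · (∂_z^{m_z}∂_r^{m_r}((1/r)∂_r)^{m_c} f)(x). -/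
open MeasureTheory

noncomputable section

/-- the compound cylindrical derivative `𝒟^𝔐 = ∂_z^{m_z} ∘ ∂_r^{m_r} ∘ ((1/r)∂_r)^{m_c}` -/
def Dop (mc mr mz : ℕ) (f : R3 → ℝ) : R3 → ℝ := dZ^[mz] (dR^[mr] (dRr^[mc] f))

/-- the double factorial `(2k−1)!! = ∏_{j=1}^k (2j−1)`, with `(−1)!! = 1` -/
def oddDF (k : ℕ) : ℕ := ∏ j ∈ Finset.range k, (2 * j + 1)

/-- directional derivative in a constant direction -/
def Dv (v : R3) (u : R3 → ℝ) : R3 → ℝ := fun y => fderiv ℝ u y v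

/-- smooth at every point off the axis -/
def SmU (u : R3 → ℝ) : Prop := ∀ y ∈ U, ContDiffAt ℝ (⊤ : ℕ∞) u y

lemma Dv_smooth {u : R3 → ℝ} (hu : ContDiff ℝ (⊤ : ℕ∞) u) (v : R3) :
    ContDiff ℝ (⊤ : ℕ∞) (Dv v u) :=
  (hu.fderiv_right (by simp)).clm_apply contDiff_const

lemma Dv_iter_smooth {u : R3 → ℝ} (hu : ContDiff ℝ (⊤ : ℕ∞) u) (v : R3) (n : ℕ) :
    ContDiff ℝ (⊤ : ℕ∞) ((Dv v)^[n] u) := by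
  induction n with
  | zero => simpa using hu
  | succ n ih => rw [Function.iterate_succ_apply']; exact Dv_smooth ih v

lemma SmU_Dv {u : R3 → ℝ} (hu : SmU u) (v : R3) : SmU (Dv v u) := fun y hy =>
  ((hu y hy).fderiv_right (by simp)).clm_apply contDiffAt_const

lemma SmU_pd {u : R3 → ℝ} (hu : SmU u) (i : Fin 3) : SmU (pd i u) := SmU_Dv hu _

lemma SmU_coord (i : Fin 3) : SmU (fun y => y i) := fun y _ =>
  (contDiff_apply ℝ ℝ i).contDiffAt

lemma sq_pos_of_U {y : R3} (hy : y ∈ U) : 0 < y 0 ^ 2 + y 1 ^ 2 := Real.sqrt_pos.mp hy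

lemma rr_sq (y : R3) : rr y ^ 2 = y 0 ^ 2 + y 1 ^ 2 := Real.sq_sqrt (by positivity)

lemma SmU_rr : SmU rr := fun y hy => by
  unfold rr
  exact ((((SmU_coord 0) y hy).pow 2).add (((SmU_coord 1) y hy).pow 2)).sqrt (sq_pos_of_U hy).ne'

lemma SmU_dR {u : R3 → ℝ} (hu : SmU u) : SmU (dR u) := fun y hy =>
  (((SmU_coord 0 y hy).mul (SmU_pd hu 0 y hy)).add
    ((SmU_coord 1 y hy).mul (SmU_pd hu 1 y hy))).div (SmU_rr y hy) (ne_of_gt hy)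

lemma SmU_dRr {u : R3 → ℝ} (hu : SmU u) : SmU (dRr u) := fun y hy =>
  (SmU_dR hu y hy).div (SmU_rr y hy) (ne_of_gt hy)

lemma isOpen_U : IsOpen U := by
  have : Continuous rr := by unfold rr; fun_prop
  exact isOpen_lt continuous_const this

lemma fderiv_expand (u : R3 → ℝ) (y v : R3) :
    fderiv ℝ u y v = v 0 * pd 0 u y + v 1 * pd 1 u y + v 2 * pd 2 u y := by
  have h : v = v 0 • Pi.single 0 (1:ℝ) + v 1 • Pi.single 1 (1:ℝ) + v 2 • Pi.single 2 (1:ℝ) := by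
    ext i; fin_cases i <;> simp
  conv_lhs => rw [h]
  simp only [map_add, map_smul, smul_eq_mul, pd]

lemma dR_eq (u : R3 → ℝ) (y : R3) : dR u y = fderiv ℝ u y (er y) := by
  rw [fderiv_expand]; simp [er, dR]; ring

lemma dZ_eq (u : R3 → ℝ) (y : R3) : dZ u y = fderiv ℝ u y ez := by
  rw [fderiv_expand]; simp [ez, dZ]

lemma pd_axisym {u : R3 → ℝ} (hax : axisym u) {y : R3} (hy : y ∈ U) :
    pd 0 u y = y 0 * dRr u y ∧ pd 1 u y = y 1 * dRr u y := by
  have h := hax y hy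
  have hr := rr_sq y
  have hp : rr y ≠ 0 := ne_of_gt hy
  unfold dTheta at h
  unfold dRr dR
  constructor
  · field_simp
    rw [hr]; linear_combination (-y 1) * h
  · field_simp
    rw [hr]; linear_combination (y 0) * h

lemma two_le_top' : (2 : WithTop ℕ∞) ≤ ((⊤ : ℕ∞) : WithTop ℕ∞) := by
  exact WithTop.coe_le_coe.mpr (le_top : (2 : ℕ∞) ≤ ⊤)

lemma Dv_comm {u : R3 → ℝ} (hu : ContDiff ℝ (⊤ : ℕ∞) u) (a b : R3) :
    Dv a (Dv b u) = Dv b (Dv a u) := by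
  funext y
  have hs : IsSymmSndFDerivAt ℝ u y := hu.contDiffAt.isSymmSndFDerivAt (by simpa using two_le_top')
  have hd : DifferentiableAt ℝ (fderiv ℝ u) y :=
    (hu.fderiv_right (m := (⊤ : ℕ∞)) (by simp)).differentiable (by simp) y
  have key : ∀ a b : R3, Dv a (Dv b u) y = fderiv ℝ (fderiv ℝ u) y a b := by
    intro a b
    unfold Dv
    rw [fderiv_clm_apply hd (by fun_prop)]
    simp
  rw [key, key]; exact hs _ _

lemma Dv_comm_iter {u : R3 → ℝ} (hu : ContDiff ℝ (⊤ : ℕ∞) u) (a b : R3) (n : ℕ) :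
    Dv a ((Dv b)^[n] u) = (Dv b)^[n] (Dv a u) := by
  induction n with
  | zero => rfl
  | succ n ih =>
    rw [Function.iterate_succ_apply', Function.iterate_succ_apply', ← ih,
      Dv_comm (Dv_iter_smooth hu b n)]

lemma Dv_iter_comm {u : R3 → ℝ} (hu : ContDiff ℝ (⊤ : ℕ∞) u) (a b : R3) (m n : ℕ) :
    (Dv a)^[m] ((Dv b)^[n] u) = (Dv b)^[n] ((Dv a)^[m] u) := by
  induction m with
  | zero => rfl
  | succ m ih =>
    rw [Function.iterate_succ_apply', Function.iterate_succ_apply', ih,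
      Dv_comm_iter (Dv_iter_smooth hu a m)]

lemma axisym_dRr {u : R3 → ℝ} (hu : SmU u) (hax : axisym u) : axisym (dRr u) := by
  intro y hy
  have hs : IsSymmSndFDerivAt ℝ u y := (hu y hy).isSymmSndFDerivAt (by simpa using two_le_top')
  have hd : DifferentiableAt ℝ (fderiv ℝ u) y :=
    ((hu y hy).fderiv_right (m := (⊤ : ℕ∞)) (by simp)).differentiableAt (by simp)
  have key : ∀ i j : Fin 3, pd i (pd j u) y
      = fderiv ℝ (fderiv ℝ u) y (Pi.single i 1) (Pi.single j 1) := by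
    intro i j
    unfold pd
    rw [fderiv_clm_apply hd (by fun_prop)]
    simp
  have hsym : pd 1 (pd 0 u) y = pd 0 (pd 1 u) y := by
    rw [key, key]; exact hs _ _
  have hw : DifferentiableAt ℝ (dRr u) y := (SmU_dRr hu y hy).differentiableAt (by simp)
  have hev : ∀ᶠ z in nhds y, z ∈ U := isOpen_U.mem_nhds hy
  have hc : ∀ i : Fin 3, HasFDerivAt (fun z : R3 => z i) (ContinuousLinearMap.proj (R := ℝ) i) y :=
    fun i => (ContinuousLinearMap.proj (R := ℝ) (φ := fun _ : Fin 3 => ℝ) i).hasFDerivAt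
  have e0 : pd 1 (pd 0 u) y = y 0 * pd 1 (dRr u) y := by
    have : pd 0 u =ᶠ[nhds y] fun z => z 0 * dRr u z := by
      filter_upwards [hev] with z hz using (pd_axisym hax hz).1
    have h2 : fderiv ℝ (fun z => z 0 * dRr u z) y = _ := ((hc 0).mul hw.hasFDerivAt).fderiv
    conv_lhs => rw [pd, this.fderiv_eq, h2]
    simp [pd]
  have e1 : pd 0 (pd 1 u) y = y 1 * pd 0 (dRr u) y := by
    have : pd 1 u =ᶠ[nhds y] fun z => z 1 * dRr u z := by
      filter_upwards [hev] with z hz using (pd_axisym hax hz).2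
    have h2 : fderiv ℝ (fun z => z 1 * dRr u z) y = _ := ((hc 1).mul hw.hasFDerivAt).fderiv
    conv_lhs => rw [pd, this.fderiv_eq, h2]
    simp [pd]
  unfold dTheta
  linarith

lemma dRr_iter {f : R3 → ℝ} (hf : SmU f) (hax : axisym f) (k : ℕ) :
    SmU (dRr^[k] f) ∧ axisym (dRr^[k] f) := by
  induction k with
  | zero => exact ⟨hf, hax⟩
  | succ k ih =>
    rw [Function.iterate_succ_apply']
    exact ⟨SmU_dRr ih.1, axisym_dRr ih.1 ih.2⟩

lemma seq_smooth (g : ℕ → ℝ → ℝ) (hg : ∀ k t, HasDerivAt (g k) (t * g (k + 1) t) t) (n : ℕ) :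
    ∀ k, ContDiff ℝ n (g k) := by
  induction n with
  | zero =>
    intro k
    exact contDiff_zero.mpr (continuous_iff_continuousAt.mpr fun t => (hg k t).continuousAt)
  | succ n ih =>
    intro k
    have hd : deriv (g k) = fun t => t * g (k + 1) t := funext fun t => (hg k t).deriv
    push_cast
    rw [contDiff_succ_iff_deriv]
    refine ⟨fun t => (hg k t).differentiableAt, by simp, ?_⟩
    rw [hd]
    exact contDiff_id.mul (ih (k + 1))

lemma iter_mul_id (h : ℝ → ℝ) (hh : ∀ n : ℕ, ContDiff ℝ n h) (n : ℕ) :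
    iteratedDeriv (n + 1) (fun t => t * h t)
      = fun t => t * iteratedDeriv (n + 1) h t + (n + 1) * iteratedDeriv n h t := by
  have hd : ∀ n t, HasDerivAt (iteratedDeriv n h) (iteratedDeriv (n + 1) h t) t := by
    intro n t
    rw [iteratedDeriv_succ]
    exact (((hh (n + 1)).differentiable_iteratedDeriv n (by exact_mod_cast Nat.lt_succ_self n)) t).hasDerivAt
  induction n with
  | zero =>
    funext t
    have := (hasDerivAt_id t).mul (hd 0 t)
    rw [iteratedDeriv_succ]
    simp only [iteratedDeriv_zero] at this ⊢
    refine this.deriv.trans ?_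
    simp; ring
  | succ n ih =>
    funext t
    rw [iteratedDeriv_succ, ih]
    have := ((hasDerivAt_id t).mul (hd (n + 1) t)).add ((hd n t).const_mul ((n : ℝ) + 1))
    refine this.deriv.trans ?_
    simp; ring

lemma seq_deriv (g : ℕ → ℝ → ℝ) (hg : ∀ k t, HasDerivAt (g k) (t * g (k + 1) t) t) (k : ℕ) :
    ∀ j, iteratedDeriv (2 * k) (g j) 0 = (oddDF k : ℝ) * g (j + k) 0 := by
  induction k with
  | zero => intro j; simp [oddDF]
  | succ k ih =>
    intro j
    have hd : deriv (g j) = fun t => t * g (j + 1) t := funext fun t => (hg j t).deriv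
    rw [show 2 * (k + 1) = (2 * k + 1) + 1 by ring, iteratedDeriv_succ', hd,
      iter_mul_id _ (fun n => seq_smooth g hg n (j + 1))]
    simp only []
    rw [ih]
    rw [show j + 1 + k = j + (k + 1) by ring]
    unfold oddDF
    rw [Finset.prod_range_succ]
    push_cast
    ring

lemma line_deriv (u : R3 → ℝ) (y e : R3) (t : ℝ) (hu : DifferentiableAt ℝ u (y + t • e)) :
    HasDerivAt (fun s : ℝ => u (y + s • e)) (fderiv ℝ u (y + t • e) e) t := by
  have h : HasDerivAt (fun s : ℝ => y + s • e) e t := by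
    simpa using ((hasDerivAt_id t).smul_const e).const_add y
  exact hu.hasFDerivAt.comp_hasDerivAt t h

lemma iter_line {u : R3 → ℝ} (hu : ContDiff ℝ (⊤ : ℕ∞) u) (y e : R3) (n : ℕ) :
    iteratedDeriv n (fun s : ℝ => u (y + s • e)) = fun t => (Dv e)^[n] u (y + t • e) := by
  induction n with
  | zero => funext t; simp
  | succ n ih =>
    funext t
    rw [iteratedDeriv_succ, ih, Function.iterate_succ_apply']
    exact (line_deriv _ y e t
      ((Dv_iter_smooth hu e n).differentiable (by simp) _)).deriv

lemma theta_part {f : R3 → ℝ} (hf : ContDiff ℝ (⊤ : ℕ∞) f) (hax : axisym f) (k : ℕ)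
    {y : R3} (hy : y ∈ U) :
    (Dv (etheta y))^[2 * k] f y = (oddDF k : ℝ) * dRr^[k] f y := by
  have hS : SmU f := fun z _ => hf.contDiffAt
  have hp : rr y ≠ 0 := ne_of_gt hy
  have hr := rr_sq y
  have hpos := sq_pos_of_U hy
  have hU : ∀ t : ℝ, y + t • etheta y ∈ U := by
    intro t
    refine Real.sqrt_pos.mpr ?_
    have : (y + t • etheta y) 0 ^ 2 + (y + t • etheta y) 1 ^ 2 = y 0 ^ 2 + y 1 ^ 2 + t ^ 2 := by
      simp [etheta]
      field_simp
      linear_combination (-t ^ 2) * hr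
    rw [this]; positivity
  have hg : ∀ k t, HasDerivAt (fun t : ℝ => dRr^[k] f (y + t • etheta y))
      (t * dRr^[k + 1] f (y + t • etheta y)) t := by
    intro k t
    obtain ⟨h1, h2⟩ := dRr_iter hS hax k
    have := line_deriv _ y (etheta y) t ((h1 _ (hU t)).differentiableAt (by simp))
    convert this using 1
    rw [fderiv_expand, (pd_axisym h2 (hU t)).1, (pd_axisym h2 (hU t)).2,
      Function.iterate_succ_apply']
    simp [etheta]
    field_simp
    rw [hr]; ring
  have := seq_deriv (fun k t => dRr^[k] f (y + t • etheta y)) hg k 0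
  simp only [Function.iterate_zero, id, zero_add] at this
  rw [iter_line hf] at this
  simpa using this

/-- the open half plane through the axis with direction `e` -/
def HP (e : R3) : Set R3 := {y | ∃ ρ : ℝ, 0 < ρ ∧ y 0 = ρ * e 0 ∧ y 1 = ρ * e 1}

lemma HP_er {x : R3} (hx : x ∈ U) {y : R3} (hy : y ∈ HP (er x)) :
    y ∈ U ∧ er y = er x ∧ etheta y = etheta x := by
  obtain ⟨ρ, hρ, h0, h1⟩ := hy
  have hp : rr x ≠ 0 := ne_of_gt hx
  have hr := rr_sq x
  have hry : rr y = ρ := by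
    unfold rr
    rw [Real.sqrt_eq_iff_mul_self_eq (by positivity) hρ.le, h0, h1]
    simp [er]
    field_simp
    rw [hr]
  simp [er] at h0 h1
  refine ⟨by change 0 < rr y; rwa [hry], ?_, ?_⟩
  · ext i; fin_cases i <;> simp [er, hry, h0, h1, hρ.ne']
  · ext i; fin_cases i <;> simp [etheta, hry, h0, h1] <;> field_simp

lemma HP_self {x : R3} (hx : x ∈ U) : x ∈ HP (er x) := by
  have hp : rr x ≠ 0 := ne_of_gt hx
  refine ⟨rr x, hx, ?_, ?_⟩ <;> simp [er] <;> field_simp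

lemma agree_line {S : Set R3} {u v : R3 → ℝ} (h : ∀ y ∈ S, u y = v y) {y e : R3}
    (hS : ∀ᶠ t : ℝ in nhds 0, y + t • e ∈ S) (hu : DifferentiableAt ℝ u y)
    (hv : DifferentiableAt ℝ v y) : fderiv ℝ u y e = fderiv ℝ v y e := by
  have h1 := line_deriv u y e 0 (by simpa using hu)
  have h2 := line_deriv v y e 0 (by simpa using hv)
  have : (fun s : ℝ => u (y + s • e)) =ᶠ[nhds 0] fun s : ℝ => v (y + s • e) := by
    filter_upwards [hS] with t ht using h _ ht
  have := (h1.congr_of_eventuallyEq this.symm).unique h2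
  simpa using this

lemma r_part {x : R3} (hx : x ∈ U) (n : ℕ) {u v : R3 → ℝ} (hu : SmU u) (hv : SmU v)
    (h : ∀ y ∈ HP (er x), u y = v y) :
    SmU (dR^[n] u) ∧ SmU ((Dv (er x))^[n] v) ∧
      ∀ y ∈ HP (er x), dR^[n] u y = (Dv (er x))^[n] v y := by
  induction n with
  | zero => exact ⟨hu, hv, h⟩
  | succ n ih =>
    obtain ⟨a, b, c⟩ := ih
    simp only [Function.iterate_succ_apply']
    refine ⟨SmU_dR a, SmU_Dv b _, fun y hy => ?_⟩
    obtain ⟨hyU, he, -⟩ := HP_er hx hy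
    rw [dR_eq, he]
    refine agree_line c ?_ ((a y hyU).differentiableAt (by simp))
      ((b y hyU).differentiableAt (by simp))
    obtain ⟨ρ, hρ, h0, h1⟩ := hy
    filter_upwards [lt_mem_nhds (show -ρ < 0 by linarith)] with t ht
    refine ⟨ρ + t, by linarith, ?_, ?_⟩
    · simp [h0]; ring
    · simp [h1]; ring

lemma z_part {x : R3} (hx : x ∈ U) (n : ℕ) {u v : R3 → ℝ} (hu : SmU u) (hv : SmU v)
    (h : ∀ y ∈ HP (er x), u y = v y) :
    SmU (dZ^[n] u) ∧ SmU ((Dv ez)^[n] v) ∧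
      ∀ y ∈ HP (er x), dZ^[n] u y = (Dv ez)^[n] v y := by
  induction n with
  | zero => exact ⟨hu, hv, h⟩
  | succ n ih =>
    obtain ⟨a, b, c⟩ := ih
    simp only [Function.iterate_succ_apply']
    refine ⟨SmU_pd a _, SmU_Dv b _, fun y hy => ?_⟩
    obtain ⟨hyU, he, -⟩ := HP_er hx hy
    rw [dZ_eq]
    refine agree_line c ?_ ((a y hyU).differentiableAt (by simp))
      ((b y hyU).differentiableAt (by simp))
    obtain ⟨ρ, hρ, h0, h1⟩ := hy
    refine Filter.Eventually.of_forall fun t => ⟨ρ, hρ, ?_, ?_⟩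
    · simp [h0, ez]
    · simp [h1, ez]

lemma peel_one {f : R3 → ℝ} (hf : ContDiff ℝ (⊤ : ℕ∞) f) (n : ℕ) (w : ℕ → R3) (x : R3) :
    iteratedFDeriv ℝ (n + 1) f x (fun i => w i)
      = iteratedFDeriv ℝ n (Dv (w n) f) x (fun i => w i) := by
  rw [iteratedFDeriv_succ_apply_right]
  have hd : ContDiffAt ℝ n (fderiv ℝ f) x :=
    (hf.fderiv_right (m := n) (by exact_mod_cast le_top)).contDiffAt
  have := (ContinuousLinearMap.apply ℝ ℝ (w n)).iteratedFDeriv_comp_left hd (i := n) le_rfl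
  have e : Dv (w n) f = (ContinuousLinearMap.apply ℝ ℝ (w n)) ∘ fderiv ℝ f := by
    funext y; simp [Dv]
  rw [e, this]
  simp [Fin.init]
  rfl

lemma peel {f : R3 → ℝ} (hf : ContDiff ℝ (⊤ : ℕ∞) f) (a : ℕ) (w : ℕ → R3) (e x : R3) (b : ℕ)
    (hw : ∀ i, a ≤ i → i < a + b → w i = e) :
    iteratedFDeriv ℝ (a + b) f x (fun i => w i)
      = iteratedFDeriv ℝ a ((Dv e)^[b] f) x (fun i => w i) := by
  induction b generalizing f with
  | zero => rfl
  | succ b ih =>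
    rw [← add_assoc, peel_one hf, hw (a + b) (by omega) (by omega), Function.iterate_succ_apply]
    exact ih (Dv_smooth hf e) (fun i h1 h2 => hw i h1 (by omega))

theorem stmt_4 (f : R3 → ℝ) (hf : ContDiff ℝ (⊤ : ℕ∞) f) (hax : axisym f)
    (mc mr mz : ℕ) (x : R3) (hx : x ∈ U) :
    iteratedFDeriv ℝ (2 * mc + mr + mz) f x
      (fun i => if (i : ℕ) < 2 * mc then etheta x
                else if (i : ℕ) < 2 * mc + mr then er x else ez)
      = (oddDF mc : ℝ) * Dop mc mr mz f x := by
  set w : ℕ → R3 := fun i => if i < 2 * mc then etheta x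
    else if i < 2 * mc + mr then er x else ez with hw
  have s1 := Dv_iter_smooth hf (etheta x) (2 * mc)
  have t1 := Dv_iter_smooth hf ez mz
  have t2 := Dv_iter_smooth t1 (er x) mr
  have h1 := peel hf (2 * mc + mr) w ez x mz (by
      intro i h1 h2; simp only [hw]; rw [if_neg (by omega), if_neg (by omega)])
  have h2 := peel t1 (2 * mc) w (er x) x mr (by
      intro i h1 h2; simp only [hw]; rw [if_neg (by omega), if_pos (by omega)])
  have h3 := peel t2 0 w (etheta x) x (2 * mc) (by
      intro i h1 h2; simp only [hw]; rw [if_pos (by omega)])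
  rw [zero_add] at h3
  refine (h1.trans (h2.trans h3)).trans ?_
  rw [iteratedFDeriv_zero_apply, Dv_iter_comm t1, Dv_iter_comm hf (etheta x) ez,
    Dv_iter_comm s1 (er x) ez]
  set c : ℝ := (oddDF mc : ℝ) with hc
  have hc0 : c ≠ 0 := by
    rw [hc]; unfold oddDF
    exact_mod_cast (Finset.prod_pos fun j _ => by omega).ne'
  have lin : ∀ (v : R3) (n : ℕ) (u : R3 → ℝ), (Dv v)^[n] (fun y => c * u y)
      = fun y => c * (Dv v)^[n] u y := by
    intro v n
    induction n with
    | zero => intro u; rfl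
    | succ n ih =>
      intro u
      rw [Function.iterate_succ_apply, Function.iterate_succ_apply, ← ih]
      congr 1
      funext y
      have := fderiv_const_smul_field (𝕜 := ℝ) (f := u) c
      exact congrArg (fun L => L y v) this
  have hS : SmU f := fun z _ => hf.contDiffAt
  have hv : SmU (fun y => c⁻¹ * (Dv (etheta x))^[2 * mc] f y) := fun z _ =>
    contDiffAt_const.mul s1.contDiffAt
  obtain ⟨a, b, h⟩ := r_part hx mr (dRr_iter hS hax mc).1 hv (by
    intro y hy
    obtain ⟨hyU, -, ht⟩ := HP_er hx hy
    rw [← ht, theta_part hf hax mc hyU, inv_mul_cancel_left₀ hc0])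
  obtain ⟨-, -, h'⟩ := z_part hx mz a b h
  unfold Dop
  rw [h' x (HP_self hx)]
  have : (Dv (etheta x))^[2 * mc] f = fun y => c * (c⁻¹ * (Dv (etheta x))^[2 * mc] f y) := by
    funext y; rw [mul_inv_cancel_left₀ hc0]
  conv_lhs => rw [this, lin, lin]
end
end

section
/- Let u : ℝ³ → ℝ³ be a smooth divergence-free vector field with cylindrical components u_r=u·e_r, u_θ=u·e_θ, u_z=u·e_z, and let f : ℝ³ → ℝ be smooth and axisymmetric. Then on U: (1/r)∂_r((u_r∂_r + u_z∂_z)f) − (u_r∂_r + u_z∂_z)((1/r)∂_r f) = ((∂_r u_z)/r)·∂_z f − ((1/r)∂_θ u_θ + ∂_z u_z)·(1/r)∂_r f. -/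
open MeasureTheory

noncomputable section

/-- Euclidean dot product on `ℝ³` -/
def dot (a b : R3) : ℝ := ∑ j : Fin 3, a j * b j

/-- radial cylindrical component `u_r = u · e_r` -/
def compR (u : R3 → R3) : R3 → ℝ := fun y => dot (u y) (er y)
/-- azimuthal cylindrical component `u_θ = u · e_θ` -/
def compTh (u : R3 → R3) : R3 → ℝ := fun y => dot (u y) (etheta y)
/-- vertical cylindrical component `u_z = u · e_z` -/
def compZ (u : R3 → R3) : R3 → ℝ := fun y => dot (u y) ez

/-- divergence-free vector field -/
def divFree (u : R3 → R3) : Prop := ∀ x : R3, (∑ i : Fin 3, pd i (fun y => u y i) x) = 0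


theorem aux_pd_add {g h : R3 → ℝ} {x : R3} (i : Fin 3) (hg : DifferentiableAt ℝ g x)
    (hh : DifferentiableAt ℝ h x) : pd i (fun y => g y + h y) x = pd i g x + pd i h x := by
  simp only [pd]
  rw [fderiv_fun_add hg hh]; rfl

theorem aux_pd_mul {g h : R3 → ℝ} {x : R3} (i : Fin 3) (hg : DifferentiableAt ℝ g x)
    (hh : DifferentiableAt ℝ h x) :
    pd i (fun y => g y * h y) x = pd i g x * h x + g x * pd i h x := by
  simp only [pd]
  rw [fderiv_fun_mul hg hh]
  simp
  ring

theorem aux_pd_coord (i j : Fin 3) (x : R3) :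
    pd i (fun y => y j) x = (Pi.single i 1 : R3) j := by
  simp only [pd]
  have : HasFDerivAt (fun y : R3 => y j) (ContinuousLinearMap.proj (R := ℝ) j) x :=
    (ContinuousLinearMap.proj (R := ℝ) (φ := fun _ : Fin 3 => ℝ) j).hasFDerivAt
  rw [this.fderiv]; rfl

theorem aux_rr_sq (x : R3) : rr x ^ 2 = x 0 ^ 2 + x 1 ^ 2 :=
  Real.sq_sqrt (by positivity)

theorem aux_rr_diff {x : R3} (hx : x ∈ U) : DifferentiableAt ℝ rr x := by
  have h : x 0 ^ 2 + x 1 ^ 2 ≠ 0 := by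
    rw [← aux_rr_sq]; exact pow_ne_zero _ (ne_of_gt hx)
  unfold rr
  exact DifferentiableAt.sqrt (by fun_prop) h

theorem aux_pd_rr {x : R3} (hx : x ∈ U) (i : Fin 3) :
    rr x * pd i rr x = x 0 * (Pi.single i 1 : R3) 0 + x 1 * (Pi.single i 1 : R3) 1 := by
  have hd := aux_rr_diff hx
  have e : (fun y : R3 => rr y * rr y) = fun y => y 0 * y 0 + y 1 * y 1 := by
    funext y
    have := aux_rr_sq y
    nlinarith
  have h1 := aux_pd_mul i hd hd
  rw [e, aux_pd_add i (by fun_prop) (by fun_prop), aux_pd_mul i (by fun_prop) (by fun_prop),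
    aux_pd_mul i (by fun_prop) (by fun_prop), aux_pd_coord, aux_pd_coord] at h1
  linarith

theorem aux_diff_div {g h : R3 → ℝ} {x : R3} (hg : DifferentiableAt ℝ g x)
    (hh : DifferentiableAt ℝ h x) (h0 : h x ≠ 0) : DifferentiableAt ℝ (fun y => g y / h y) x := by
  simp only [div_eq_mul_inv]
  exact hg.fun_mul (hh.fun_inv h0)

theorem aux_pd_div {g h : R3 → ℝ} {x : R3} (i : Fin 3) (hg : DifferentiableAt ℝ g x)
    (hh : DifferentiableAt ℝ h x) (h0 : h x ≠ 0) :
    pd i (fun y => g y / h y) x = (pd i g x * h x - g x * pd i h x) / h x ^ 2 := by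
  have hq : DifferentiableAt ℝ (fun y => g y / h y) x := aux_diff_div hg hh h0
  have h1 := aux_pd_mul i hq hh
  have e : (fun y => g y / h y * h y) =ᶠ[nhds x] g := by
    filter_upwards [hh.continuousAt.eventually_ne h0] with y hy
    field_simp
  have h2 : pd i (fun y => g y / h y * h y) x = pd i g x := by
    simp only [pd]; rw [e.fderiv_eq]
  rw [h2] at h1
  rw [h1]; field_simp; ring

theorem aux_pd_contDiff {f : R3 → ℝ} (hf : ContDiff ℝ (⊤ : ℕ∞) f) (i : Fin 3) :
    ContDiff ℝ (⊤ : ℕ∞) (pd i f) := by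
  unfold pd
  exact (hf.fderiv_right (m := (⊤ : ℕ∞)) (by simp)).clm_apply contDiff_const

theorem aux_pd_diff {f : R3 → ℝ} (hf : ContDiff ℝ (⊤ : ℕ∞) f) (i : Fin 3) (x : R3) :
    DifferentiableAt ℝ (pd i f) x :=
  ((aux_pd_contDiff hf i).differentiable (by simp)) x

theorem aux_pd_comm {f : R3 → ℝ} (hf : ContDiff ℝ (⊤ : ℕ∞) f) (i j : Fin 3) (x : R3) :
    pd i (pd j f) x = pd j (pd i f) x := by
  have hd : DifferentiableAt ℝ (fderiv ℝ f) x :=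
    ((hf.fderiv_right (m := (⊤ : ℕ∞)) (by simp)).differentiable (by simp)) x
  have key : ∀ i j : Fin 3, pd i (pd j f) x
      = fderiv ℝ (fderiv ℝ f) x (Pi.single i 1) (Pi.single j 1) := by
    intro i j
    change fderiv ℝ (fun y => fderiv ℝ f y (Pi.single j 1)) x (Pi.single i 1) = _
    rw [fderiv_clm_apply hd (by fun_prop)]
    simp
  rw [key, key]
  have := (hf.contDiffAt (x := x)).isSymmSndFDerivAt
    (by simpa using (WithTop.coe_le_coe.2 (le_top : (2 : ℕ∞) ≤ ⊤)))
  exact this _ _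

theorem aux_dR_diff {f : R3 → ℝ} (hf : ContDiff ℝ (⊤ : ℕ∞) f) {x : R3} (hx : x ∈ U) :
    DifferentiableAt ℝ (dR f) x := by
  have h0 := aux_pd_diff hf 0 x
  have h1 := aux_pd_diff hf 1 x
  have hr := aux_rr_diff hx
  unfold dR
  exact aux_diff_div (by fun_prop) hr (show 0 < rr x from hx).ne'

theorem aux_dR_add {g h : R3 → ℝ} {x : R3} (hg : DifferentiableAt ℝ g x)
    (hh : DifferentiableAt ℝ h x) : dR (fun y => g y + h y) x = dR g x + dR h x := by
  simp only [dR, aux_pd_add _ hg hh]; ring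

theorem aux_dR_mul {g h : R3 → ℝ} {x : R3} (hg : DifferentiableAt ℝ g x)
    (hh : DifferentiableAt ℝ h x) :
    dR (fun y => g y * h y) x = dR g x * h x + g x * dR h x := by
  simp only [dR, aux_pd_mul _ hg hh]; ring

theorem aux_pd_rr0 {x : R3} (hx : x ∈ U) : pd 0 rr x = x 0 / rr x := by
  have h := aux_pd_rr hx 0
  have hr : rr x ≠ 0 := ne_of_gt hx
  rw [eq_div_iff hr, mul_comm, h]; simp

theorem aux_pd_rr1 {x : R3} (hx : x ∈ U) : pd 1 rr x = x 1 / rr x := by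
  have h := aux_pd_rr hx 1
  have hr : rr x ≠ 0 := ne_of_gt hx
  rw [eq_div_iff hr, mul_comm, h]; simp

theorem aux_pd_rr2 {x : R3} (hx : x ∈ U) : pd 2 rr x = 0 := by
  have h := aux_pd_rr hx 2
  have hr : rr x ≠ 0 := ne_of_gt hx
  simpa [hr] using h

theorem aux_dR_dRr {f : R3 → ℝ} (hf : ContDiff ℝ (⊤ : ℕ∞) f) {x : R3} (hx : x ∈ U) :
    dR (dRr f) x = dR (dR f) x / rr x - dR f x / rr x ^ 2 := by
  have hr : rr x ≠ 0 := ne_of_gt hx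
  have hs := aux_rr_sq x
  have e : dR (dRr f) x = (x 0 * pd 0 (dRr f) x + x 1 * pd 1 (dRr f) x) / rr x := rfl
  have e2 : dR (dR f) x = (x 0 * pd 0 (dR f) x + x 1 * pd 1 (dR f) x) / rr x := rfl
  have hp : ∀ i, pd i (dRr f) x = (pd i (dR f) x * rr x - dR f x * pd i rr x) / rr x ^ 2 :=
    fun i => aux_pd_div i (aux_dR_diff hf hx) (aux_rr_diff hx) hr
  rw [e, e2, hp, hp, aux_pd_rr0 hx, aux_pd_rr1 hx]
  generalize dR f x = a
  generalize pd 0 (dR f) x = b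
  generalize pd 1 (dR f) x = c
  field_simp
  linear_combination (a) * hs

theorem aux_dZ_dRr {f : R3 → ℝ} (hf : ContDiff ℝ (⊤ : ℕ∞) f) {x : R3} (hx : x ∈ U) :
    dZ (dRr f) x = dR (dZ f) x / rr x := by
  have hr : rr x ≠ 0 := ne_of_gt hx
  have hp : dZ (dRr f) x = (pd 2 (dR f) x * rr x - dR f x * pd 2 rr x) / rr x ^ 2 :=
    aux_pd_div 2 (aux_dR_diff hf hx) (aux_rr_diff hx) hr
  have h0 := aux_pd_diff hf 0 x
  have h1 := aux_pd_diff hf 1 x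
  have hq : pd 2 (dR f) x = dR (dZ f) x := by
    unfold dR
    rw [aux_pd_div 2 (by fun_prop) (aux_rr_diff hx) hr, aux_pd_rr2 hx,
      aux_pd_add 2 (by fun_prop) (by fun_prop), aux_pd_mul 2 (by fun_prop) h0,
      aux_pd_mul 2 (by fun_prop) h1, aux_pd_coord, aux_pd_coord]
    simp only [dZ]
    rw [aux_pd_comm hf 2 0, aux_pd_comm hf 2 1]
    simp
    field_simp
  rw [hp, hq, aux_pd_rr2 hx]
  field_simp
  ring

theorem aux_compZ (u : R3 → R3) : compZ u = fun y => u y 2 := by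
  funext y; simp [compZ, dot, ez, Fin.sum_univ_three]

theorem aux_compR (u : R3 → R3) : compR u = fun y => (u y 0 * y 0 + u y 1 * y 1) / rr y := by
  funext y; simp [compR, dot, er, Fin.sum_univ_three]; ring

theorem aux_compTh (u : R3 → R3) :
    compTh u = fun y => (u y 0 * (-1 * y 1) + u y 1 * y 0) / rr y := by
  funext y; simp [compTh, dot, etheta, Fin.sum_univ_three]; ring

theorem aux_comp_diff {u : R3 → R3} (hu : ContDiff ℝ (⊤ : ℕ∞) u) (j : Fin 3) (x : R3) :
    DifferentiableAt ℝ (fun y => u y j) x :=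
  differentiableAt_pi.1 ((hu.differentiable (by simp)) x) j

theorem aux_div {u : R3 → R3} (hu : ContDiff ℝ (⊤ : ℕ∞) u) (hdiv : divFree u) {x : R3}
    (hx : x ∈ U) :
    dR (compR u) x + compR u x / rr x + dTheta (compTh u) x / rr x + dZ (compZ u) x = 0 := by
  have hr : rr x ≠ 0 := ne_of_gt hx
  have hs := aux_rr_sq x
  have hd := hdiv x
  have h0 := aux_comp_diff hu 0 x
  have h1 := aux_comp_diff hu 1 x
  have hrd := aux_rr_diff hx
  have hc : ∀ (i j : Fin 3), pd i (fun y => -1 * y j) x = -1 * (Pi.single i 1 : R3) j := by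
    intro i j
    rw [aux_pd_mul i (by fun_prop) (by fun_prop), aux_pd_coord]
    simp [pd]
  rw [Fin.sum_univ_three] at hd
  have hR : ∀ i, pd i (compR u) x = ((pd i (fun y => u y 0) x * x 0 + u x 0 * (Pi.single i 1 : R3) 0
      + (pd i (fun y => u y 1) x * x 1 + u x 1 * (Pi.single i 1 : R3) 1)) * rr x
      - (u x 0 * x 0 + u x 1 * x 1) * pd i rr x) / rr x ^ 2 := by
    intro i
    rw [aux_compR, aux_pd_div i (by fun_prop) hrd hr, aux_pd_add i (by fun_prop) (by fun_prop),
      aux_pd_mul i h0 (by fun_prop), aux_pd_mul i h1 (by fun_prop), aux_pd_coord, aux_pd_coord]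
  have hT : ∀ i, pd i (compTh u) x = ((pd i (fun y => u y 0) x * (-1 * x 1)
      + u x 0 * (-1 * (Pi.single i 1 : R3) 1)
      + (pd i (fun y => u y 1) x * x 0 + u x 1 * (Pi.single i 1 : R3) 0)) * rr x
      - (u x 0 * (-1 * x 1) + u x 1 * x 0) * pd i rr x) / rr x ^ 2 := by
    intro i
    rw [aux_compTh, aux_pd_div i (by fun_prop) hrd hr, aux_pd_add i (by fun_prop) (by fun_prop),
      aux_pd_mul i h0 (by fun_prop), aux_pd_mul i h1 (by fun_prop), hc, aux_pd_coord]
  have hZ : dZ (compZ u) x = pd 2 (fun y => u y 2) x := by rw [aux_compZ]; rfl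
  simp only [dR, dTheta, hR, hT, hZ, aux_pd_rr0 hx, aux_pd_rr1 hx]
  simp only [aux_compR]
  have hz : pd 2 (fun y => u y 2) x = - pd 0 (fun y => u y 0) x - pd 1 (fun y => u y 1) x := by
    linarith
  rw [hz]
  simp
  generalize pd 0 (fun y => u y 0) x = a
  generalize pd 1 (fun y => u y 0) x = b
  generalize pd 0 (fun y => u y 1) x = c
  generalize pd 1 (fun y => u y 1) x = d
  generalize u x 0 = p
  generalize u x 1 = q
  generalize rr x = r at *
  generalize x 0 = s at *
  generalize x 1 = t at *
  have ht : t ^ 2 = r ^ 2 - s ^ 2 := by linarith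
  field_simp
  grind

/-- commutator identity for `(1/r)∂_r` and the advection
`u_r∂_r + u_z∂_z` of a divergence-free field applied to an axisymmetric function. -/
theorem stmt_9 (u : R3 → R3) (hu : ContDiff ℝ (⊤ : ℕ∞) u) (hdiv : divFree u)
    (f : R3 → ℝ) (hf : ContDiff ℝ (⊤ : ℕ∞) f) (hax : axisym f)
    (x : R3) (hx : x ∈ U) :
    dRr (fun y => compR u y * dR f y + compZ u y * dZ f y) x
      - (compR u x * dR (dRr f) x + compZ u x * dZ (dRr f) x)
      = (dR (compZ u) x / rr x) * dZ f x
        - (dTheta (compTh u) x / rr x + dZ (compZ u) x) * dRr f x := by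
  have hr : rr x ≠ 0 := ne_of_gt hx
  have h0 := aux_comp_diff hu 0 x
  have h1 := aux_comp_diff hu 1 x
  have hrd := aux_rr_diff hx
  have hR : DifferentiableAt ℝ (compR u) x := by
    rw [aux_compR]
    exact aux_diff_div (by fun_prop) hrd hr
  have hZ : DifferentiableAt ℝ (compZ u) x := by
    rw [aux_compZ]; exact aux_comp_diff hu 2 x
  have hF := aux_dR_diff hf hx
  have hG : DifferentiableAt ℝ (dZ f) x := aux_pd_diff hf 2 x
  have hd := aux_div hu hdiv hx
  rw [aux_dR_dRr hf hx, aux_dZ_dRr hf hx]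
  have e : dRr (fun y => compR u y * dR f y + compZ u y * dZ f y) x
      = dR (fun y => compR u y * dR f y + compZ u y * dZ f y) x / rr x := rfl
  have e2 : dRr f x = dR f x / rr x := rfl
  rw [e, e2, aux_dR_add (hR.fun_mul hF) (hZ.fun_mul hG), aux_dR_mul hR hF, aux_dR_mul hZ hG]
  linear_combination (dR f x / rr x) * hd
end
end

section
/- Let m ∈ ℕ with m ≥ 2. There exists a constant C = C(m) > 0 such that for all f ∈ C_c^∞(ℝ³;ℝ³) and g, k ∈ C_c^∞(ℝ³;ℝ): | Σ_{β∈{1,2,3}^m} ∫_{ℝ³} ( ∂^β(f·∇g)(x) − (f·∇∂^β g)(x) ) · ∂^β k(x) dx | ≤ C · ( ‖∇f‖_{L^∞} + ‖∇g‖_{L^∞} ) · ( ‖∇^m f‖_{L²}² + ‖∇^m g‖_{L²}² + ‖∇^m k‖_{L²}² ), where ∂^β = ∂_{x_{β₁}}⋯∂_{x_{β_m}}, f·∇g = Σᵢ fᵢ∂_{x_i}g, and ‖∇^j F‖_{L^p} is the L^p norm of the Euclidean norm of the j-th derivative tensor of F. -/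
open MeasureTheory

noncomputable section

/-- the iterated partial derivative `∂^β = ∂_{x_{β₁}} ⋯ ∂_{x_{β_m}}` -/
def pdMulti {m : ℕ} (β : Fin m → Fin 3) (u : R3 → ℝ) : R3 → ℝ :=
  (List.ofFn (fun i => pd (β i))).foldr (fun o g => o g) u

/-- squared Euclidean (Hilbert–Schmidt) norm of the `m`-th derivative tensor
of a scalar function -/
def DmSq (m : ℕ) (u : R3 → ℝ) (x : R3) : ℝ :=
  ∑ β : Fin m → Fin 3, (pdMulti β u x) ^ 2

/-- `‖∇g‖_{L^∞}` for a scalar function -/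
def gradSupS (g : R3 → ℝ) : ℝ := ⨆ x : R3, Real.sqrt (∑ i : Fin 3, (pd i g x) ^ 2)

/-- `‖∇f‖_{L^∞}` for a vector field -/
def gradSupV (f : R3 → R3) : ℝ :=
  ⨆ x : R3, Real.sqrt (∑ i : Fin 3, ∑ j : Fin 3, (pd j (fun y => f y i) x) ^ 2)

/-- smooth and compactly supported -/
def SC (u : R3 → ℝ) : Prop := ContDiff ℝ (⊤ : ℕ∞) u ∧ HasCompactSupport u

lemma contDiff_pd (i : Fin 3) {u : R3 → ℝ} (h : ContDiff ℝ (⊤ : ℕ∞) u) :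
    ContDiff ℝ (⊤ : ℕ∞) (pd i u) := by
  unfold pd
  exact (h.fderiv_right (m := (⊤ : ℕ∞)) (by exact le_refl _)).clm_apply contDiff_const

lemma SC.pd {u : R3 → ℝ} (h : SC u) (i : Fin 3) : SC (pd i u) :=
  ⟨contDiff_pd i h.1, HasCompactSupport.fderiv_apply ℝ h.2 _⟩

/-- list version of iterated derivative -/
def pdL (L : List (Fin 3)) (u : R3 → ℝ) : R3 → ℝ := L.foldr (fun i g => pd i g) u

lemma pdMulti_eq {m : ℕ} (β : Fin m → Fin 3) (u : R3 → ℝ) :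
    pdMulti β u = pdL (List.ofFn β) u := by
  unfold pdMulti pdL
  have : List.ofFn (fun i => pd (β i)) = (List.ofFn β).map pd := by
    rw [List.map_ofFn]; rfl
  rw [this, List.foldr_map]

lemma pdL_cons (i : Fin 3) (L) (u : R3 → ℝ) : pdL (i :: L) u = pd i (pdL L u) := rfl

lemma pdL_snoc (i : Fin 3) (L) (u : R3 → ℝ) : pdL (L ++ [i]) u = pdL L (pd i u) := by
  simp [pdL, List.foldr_append]

lemma contDiff_pdL (L) {u : R3 → ℝ} (h : ContDiff ℝ (⊤ : ℕ∞) u) :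
    ContDiff ℝ (⊤ : ℕ∞) (pdL L u) := by
  induction L with
  | nil => exact h
  | cons i L ih => exact contDiff_pd i ih

lemma SC.pdL {u : R3 → ℝ} (h : SC u) (L) : SC (pdL L u) := by
  induction L with
  | nil => exact h
  | cons i L ih => exact ih.pd i

lemma SC.diff {u : R3 → ℝ} (h : SC u) : Differentiable ℝ u := h.1.differentiable (by simp)

lemma pd_comm (i j : Fin 3) {u : R3 → ℝ} (h : ContDiff ℝ (⊤ : ℕ∞) u) :
    pd i (pd j u) = pd j (pd i u) := by
  funext x
  have hd : DifferentiableAt ℝ (fderiv ℝ u) x :=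
    (h.fderiv_right (m := (⊤ : ℕ∞)) (by exact le_refl _)).differentiable (by simp) x
  have key : ∀ a b : Fin 3, pd a (pd b u) x
      = fderiv ℝ (fderiv ℝ u) x (Pi.single a 1) (Pi.single b 1) := by
    intro a b
    unfold pd
    rw [fderiv_clm_apply hd (by fun_prop)]
    simp
  rw [key, key]
  exact ((h.contDiffAt (x := x)).isSymmSndFDerivAt (by simp only [minSmoothness_of_isRCLikeNormedField]; exact WithTop.coe_le_coe.2 (le_top (a := (2 : ℕ∞))))) _ _

lemma pd_pdL (i : Fin 3) (L) {u : R3 → ℝ} (h : ContDiff ℝ (⊤ : ℕ∞) u) :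
    pd i (pdL L u) = pdL L (pd i u) := by
  induction L with
  | nil => rfl
  | cons j L ih => rw [pdL_cons, pd_comm i j (contDiff_pdL L h), ih]; rfl

lemma pd_mul (i : Fin 3) {u v : R3 → ℝ} (hu : Differentiable ℝ u) (hv : Differentiable ℝ v) :
    pd i (fun x => u x * v x) = fun x => pd i u x * v x + u x * pd i v x := by
  funext x
  unfold pd
  rw [fderiv_fun_mul (hu x) (hv x)]
  simp; ring

lemma pd_add (i : Fin 3) {u v : R3 → ℝ} (hu : Differentiable ℝ u) (hv : Differentiable ℝ v) :
    pd i (fun x => u x + v x) = fun x => pd i u x + pd i v x := by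
  funext x
  unfold pd
  rw [fderiv_fun_add (hu x) (hv x)]
  simp

lemma pd_smul (i : Fin 3) (c : ℝ) {u : R3 → ℝ} (hu : Differentiable ℝ u) :
    pd i (fun x => c * u x) = fun x => c * pd i u x := by
  funext x
  unfold pd
  rw [fderiv_const_mul (hu x)]
  simp

lemma pdL_smul (L) (c : ℝ) {u : R3 → ℝ} (hu : ContDiff ℝ (⊤ : ℕ∞) u) :
    pdL L (fun x => c * u x) = fun x => c * pdL L u x := by
  induction L with
  | nil => rfl
  | cons j L ih =>
    rw [pdL_cons, ih, pd_smul _ _ ((contDiff_pdL L hu).differentiable (by simp))]; rfl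

lemma pdL_add (L) {u v : R3 → ℝ} (hu : ContDiff ℝ (⊤ : ℕ∞) u) (hv : ContDiff ℝ (⊤ : ℕ∞) v) :
    pdL L (fun x => u x + v x) = fun x => pdL L u x + pdL L v x := by
  induction L with
  | nil => rfl
  | cons j L ih =>
    rw [pdL_cons, ih, pd_add _ ((contDiff_pdL L hu).differentiable (by simp))
      ((contDiff_pdL L hv).differentiable (by simp))]; rfl

/-- the pairs of index lists in the Leibniz expansion of the commutator -/
def csp : List (Fin 3) → List (List (Fin 3) × List (Fin 3))
  | [] => []
  | i :: L => ([i], L) :: ((csp L).map (fun q => (i :: q.1, q.2))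
      ++ (csp L).map (fun q => (q.1, i :: q.2)))

lemma csp_len (L) : ∀ q ∈ csp L, q.1 ≠ [] ∧ q.1.length + q.2.length = L.length := by
  induction L with
  | nil => simp [csp]
  | cons i L ih =>
    intro q hq
    simp only [csp, List.mem_cons, List.mem_append, List.mem_map] at hq
    rcases hq with rfl | ⟨r, hr, rfl⟩ | ⟨r, hr, rfl⟩
    · simp; omega
    · have := ih r hr; simp; omega
    · have := ih r hr; simp [this.1]; omega

lemma leibniz (L) {u v : R3 → ℝ} (hu : ContDiff ℝ (⊤ : ℕ∞) u) (hv : ContDiff ℝ (⊤ : ℕ∞) v) :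
    pdL L (fun x => u x * v x) = fun x => u x * pdL L v x
      + ((csp L).map (fun q => pdL q.1 u x * pdL q.2 v x)).sum := by
  have du : ∀ L, Differentiable ℝ (pdL L u) :=
    fun L => (contDiff_pdL L hu).differentiable (by simp)
  have dv : ∀ L, Differentiable ℝ (pdL L v) :=
    fun L => (contDiff_pdL L hv).differentiable (by simp)
  induction L with
  | nil => simp [csp, pdL]
  | cons i L ih =>
    have hds : ∀ l : List (List (Fin 3) × List (Fin 3)), 
        pd i (fun x => (l.map (fun q => pdL q.1 u x * pdL q.2 v x)).sum)
         = (fun x => (l.map (fun q => pd i (pdL q.1 u) x * pdL q.2 v x)).sum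
            + (l.map (fun q => pdL q.1 u x * pd i (pdL q.2 v) x)).sum) ∧
        Differentiable ℝ (fun x => (l.map (fun q => pdL q.1 u x * pdL q.2 v x)).sum) := by
      intro l
      induction l with
      | nil => constructor
               · funext x; simp [pd]
               · simp
      | cons q l ihl =>
        simp only [List.map_cons, List.sum_cons]
        constructor
        · rw [pd_add i ((du _).fun_mul (dv _)) ihl.2, ihl.1, pd_mul i (du _) (dv _)]
          funext x; ring
        · exact ((du _).mul (dv _)).add ihl.2
    have du0 : Differentiable ℝ u := du []
    rw [pdL_cons, ih, pd_add i (du0.fun_mul (dv L)) (hds _).2, (hds _).1, pd_mul i du0 (dv L)]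
    funext x
    simp only [csp, List.map_cons, List.sum_cons, List.map_append, List.sum_append, List.map_map,
      Function.comp_def, pdL_cons]
    simp only [pdL, List.foldr_nil]
    ring

lemma intg {h w : R3 → ℝ} (hh : SC h) (hw : Continuous w) (h0 : ∀ x, h x = 0 → w x = 0) :
    Integrable w := by
  apply hw.integrable_of_hasCompactSupport
  apply hh.2.mono
  intro x hx hx'
  exact hx (h0 x hx')

lemma SC.cont {u : R3 → ℝ} (h : SC u) : Continuous u := h.1.continuous

lemma intg_rpow {v : R3 → ℝ} (hv : SC v) {p : ℝ} (hp : 0 < p) :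
    Integrable (fun x => |v x| ^ p) := by
  apply intg hv
  · exact hv.cont.abs.rpow_const (fun x => Or.inr hp.le)
  · intro x hx; simp [hx, Real.zero_rpow hp.ne']

lemma hasDerivAt_phi {q : ℝ} (hq : 0 < q) (t : ℝ) :
    HasDerivAt (fun t : ℝ => |t| ^ q * t) ((q + 1) * |t| ^ q) t := by
  rcases lt_trichotomy t 0 with ht | rfl | ht
  · have h1 : HasDerivAt (fun t : ℝ => (-t) ^ q * t)
        ((-1 * q * (-t) ^ (q - 1)) * t + (-t) ^ q * 1) t :=
      ((hasDerivAt_neg t).rpow_const (Or.inl (by linarith))).mul (hasDerivAt_id t)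
    have h2 : (fun t : ℝ => |t| ^ q * t) =ᶠ[nhds t] (fun t : ℝ => (-t) ^ q * t) := by
      filter_upwards [gt_mem_nhds ht] with s hs
      rw [abs_of_neg hs]
    refine (h1.congr_of_eventuallyEq h2).congr_deriv ?_
    have ht' : t ≠ 0 := ht.ne
    rw [abs_of_neg ht, Real.rpow_sub_one (by linarith), div_neg]
    field_simp
  · rw [hasDerivAt_iff_tendsto_slope]
    simp only [abs_zero, Real.zero_rpow hq.ne', mul_zero]
    have : Filter.Tendsto (fun t : ℝ => |t| ^ q) (nhdsWithin 0 {0}ᶜ) (nhds 0) := by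
      have hc : Continuous (fun t : ℝ => |t| ^ q) :=
        continuous_abs.rpow_const (fun x => Or.inr hq.le)
      have := hc.tendsto 0
      simp only [abs_zero, Real.zero_rpow hq.ne'] at this
      exact this.mono_left nhdsWithin_le_nhds
    refine this.congr' ?_
    filter_upwards [self_mem_nhdsWithin] with s hs
    have hs' : s ≠ 0 := hs
    simp [slope_def_field]
    field_simp
  · have h1 : HasDerivAt (fun t : ℝ => t ^ q * t)
        ((1 * q * t ^ (q - 1)) * t + t ^ q * 1) t :=
      ((hasDerivAt_id t).rpow_const (Or.inl ht.ne')).mul (hasDerivAt_id t)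
    have h2 : (fun t : ℝ => |t| ^ q * t) =ᶠ[nhds t] (fun t : ℝ => t ^ q * t) := by
      filter_upwards [lt_mem_nhds ht] with s hs
      rw [abs_of_pos hs]
    refine (h1.congr_of_eventuallyEq h2).congr_deriv ?_
    rw [abs_of_pos ht, Real.rpow_sub_one (by linarith)]
    field_simp

lemma ibp {v : R3 → ℝ} (hv : SC v) (i : Fin 3) {q : ℝ} (hq : 0 < q) :
    ∫ x, |pd i v x| ^ (q + 2) ≤
      ∫ x, (q + 1) * (|v x| * |pd i (pd i v) x| * |pd i v x| ^ q) := by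
  have hw := hv.pd i
  have hz := hw.pd i
  set w := pd i v with hwdef
  have hcq : Continuous (fun x => |w x| ^ q) :=
    hw.cont.abs.rpow_const (fun x => Or.inr hq.le)
  have hder : ∀ x, HasFDerivAt (fun x => |w x| ^ q * w x)
      (((q + 1) * |w x| ^ q) • fderiv ℝ w x) x := fun x =>
    (hasDerivAt_phi hq (w x)).comp_hasFDerivAt x (hw.diff x).hasFDerivAt
  have hfd : ∀ x, fderiv ℝ (fun x => |w x| ^ q * w x) x (Pi.single i 1)
      = (q + 1) * |w x| ^ q * pd i w x := by
    intro x; rw [(hder x).fderiv]; rfl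
  have key := integral_mul_fderiv_eq_neg_fderiv_mul_of_integrable (μ := (volume : Measure R3))
    (f := fun x => |w x| ^ q * w x) (g := v) (v := Pi.single i 1) ?_ ?_ ?_
    (fun x _ => (hder x).differentiableAt) (fun x _ => hv.diff x)
  · have e1 : ∀ x, |w x| ^ (q + 2) = |w x| ^ q * w x * fderiv ℝ v x (Pi.single i 1) := by
      intro x
      rw [Real.rpow_add' (abs_nonneg _) (by linarith)]
      have : fderiv ℝ v x (Pi.single i 1) = w x := rfl
      rw [this, Real.rpow_two, sq_abs]; ring
    simp_rw [e1]
    rw [key, ← integral_neg]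
    apply integral_mono
    · simp_rw [hfd]
      apply Integrable.neg
      apply intg hv
      · exact ((continuous_const.mul hcq).mul hz.cont).mul hv.cont
      · intro x hx; simp [hx]
    · apply intg hv
      · exact continuous_const.mul ((hv.cont.abs.mul hz.cont.abs).mul hcq)
      · intro x hx; simp [hx]
    · intro x
      simp only [hfd]
      refine (neg_le_abs _).trans (le_of_eq ?_)
      rw [abs_mul, abs_mul, abs_mul, abs_of_pos (by linarith : (0:ℝ) < q + 1),
        abs_of_nonneg (Real.rpow_nonneg (abs_nonneg (w x)) q)]
      ring
  · simp_rw [hfd]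
    apply intg hv
    · exact ((continuous_const.mul hcq).mul hz.cont).mul hv.cont
    · intro x hx; simp [hx]
  · apply intg hw
    · exact (hcq.mul hw.cont).mul hw.cont
    · intro x hx; simp [hx]
  · apply intg hv
    · exact (hcq.mul hw.cont).mul hv.cont
    · intro x hx; simp [hx]

lemma young {w1 w2 w3 : ℝ} (h1 : 0 ≤ w1) (h2 : 0 < w2) (h3 : 0 ≤ w3) (hs : w1 + w2 + w3 = 1)
    {ε K : ℝ} (hε : 0 < ε) (hK : 0 < K) :
    ∃ C : ℝ, 0 < C ∧ ∀ X Y Z : ℝ, 0 ≤ X → 0 ≤ Y → 0 ≤ Z →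
      K * (X ^ w1 * Y ^ w2 * Z ^ w3) ≤ ε * X + ε * Z + C * Y := by
  refine ⟨(K / (ε ^ w1 * ε ^ w3)) ^ (w2⁻¹), by positivity, ?_⟩
  intro X Y Z hX hY hZ
  set C := (K / (ε ^ w1 * ε ^ w3)) ^ (w2⁻¹) with hC
  have hCp : 0 < C := by positivity
  have hCw : C ^ w2 = K / (ε ^ w1 * ε ^ w3) := by
    rw [hC, ← Real.rpow_mul (by positivity), inv_mul_cancel₀ h2.ne', Real.rpow_one]
  have := Real.geom_mean_le_arith_mean3_weighted h1 h2.le h3 (p₁ := ε * X) (p₂ := C * Y)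
    (p₃ := ε * Z) (by positivity) (by positivity) (by positivity) hs
  rw [Real.mul_rpow hε.le hX, Real.mul_rpow hCp.le hY, Real.mul_rpow hε.le hZ, hCw] at this
  have e : ε ^ w1 * X ^ w1 * (K / (ε ^ w1 * ε ^ w3) * Y ^ w2) * (ε ^ w3 * Z ^ w3)
      = K * (X ^ w1 * Y ^ w2 * Z ^ w3) := by
    have := (Real.rpow_pos_of_pos hε w1).ne'
    have := (Real.rpow_pos_of_pos hε w3).ne'
    field_simp
  rw [e] at this
  refine this.trans ?_
  have a1 : w1 * (ε * X) ≤ 1 * (ε * X) := by gcongr; linarith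
  have a2 : w2 * (C * Y) ≤ 1 * (C * Y) := by gcongr; linarith
  have a3 : w3 * (ε * Z) ≤ 1 * (ε * Z) := by gcongr; linarith
  linarith

lemma rpow_cancel {x s t : ℝ} (hx : 0 ≤ x) (h : s * t = 1) : (x ^ s) ^ t = x := by
  rw [← Real.rpow_mul hx, h, Real.rpow_one]

lemma step {M a : ℕ} (ha : 2 ≤ a) (haM : a + 1 ≤ M) {ε : ℝ} (hε : 0 < ε) :
    ∃ C : ℝ, 0 < C ∧ ∀ (v : R3 → ℝ) (i : Fin 3), SC v →
      ∫ x, |pd i v x| ^ (2 * M / a : ℝ) ≤ ε * (∫ x, |v x| ^ (2 * M / ((a : ℝ) - 1)))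
        + ε * (∫ x, |pd i v x| ^ (2 * M / a : ℝ))
        + C * ∫ x, |pd i (pd i v) x| ^ (2 * M / ((a : ℝ) + 1)) := by
  have ha' : (2 : ℝ) ≤ a := by exact_mod_cast ha
  have hM' : (a : ℝ) + 1 ≤ M := by exact_mod_cast haM
  have hM0 : (0 : ℝ) < M := by linarith
  have ha0 : (0 : ℝ) < a := by linarith
  have ha1 : (0 : ℝ) < (a : ℝ) - 1 := by linarith
  have hq : (0 : ℝ) < 2 * M / a - 2 := by
    rw [sub_pos, lt_div_iff₀ ha0]; linarith
  obtain ⟨C, hC, H⟩ := young (w1 := ((a : ℝ) - 1) / (2 * M)) (w2 := ((a : ℝ) + 1) / (2 * M))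
    (w3 := 1 - a / M) (by positivity) (by positivity)
    (by rw [sub_nonneg, div_le_one hM0]; linarith) (by field_simp; ring) hε
    (by linarith : (0 : ℝ) < (2 * M / a - 2) + 1)
  refine ⟨C, hC, ?_⟩
  intro v i hv
  have hb := ibp hv i hq
  rw [sub_add_cancel] at hb
  refine hb.trans ?_
  have i1 := intg_rpow hv (p := 2 * M / ((a : ℝ) - 1)) (by positivity)
  have i2 := intg_rpow (hv.pd i) (p := 2 * M / (a : ℝ)) (by positivity)
  have i3 := intg_rpow ((hv.pd i).pd i) (p := 2 * M / ((a : ℝ) + 1)) (by positivity)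
  rw [← integral_const_mul, ← integral_const_mul, ← integral_const_mul,
    ← integral_add (i1.const_mul _) (i2.const_mul _),
    ← integral_add ((i1.const_mul _).fun_add (i2.const_mul _)) (i3.const_mul _)]
  apply integral_mono
  · apply intg hv
    · exact continuous_const.mul ((hv.cont.abs.mul ((hv.pd i).pd i).cont.abs).mul
        ((hv.pd i).cont.abs.rpow_const (fun x => Or.inr hq.le)))
    · intro x hx; simp [hx]
  · exact ((i1.const_mul _).add (i2.const_mul _)).add (i3.const_mul _)
  · intro x
    have := H (|v x| ^ (2 * M / ((a : ℝ) - 1))) (|pd i (pd i v) x| ^ (2 * M / ((a : ℝ) + 1)))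
      (|pd i v x| ^ (2 * M / (a : ℝ))) (by positivity) (by positivity) (by positivity)
    rw [rpow_cancel (abs_nonneg _) (by field_simp), rpow_cancel (abs_nonneg _) (by field_simp),
      ← Real.rpow_mul (abs_nonneg _),
      (by field_simp : 2 * M / (a : ℝ) * (1 - a / M) = 2 * M / a - 2)] at this
    exact this

lemma step1 {M : ℕ} (haM : 2 ≤ M) {ε : ℝ} (hε : 0 < ε) :
    ∃ C : ℝ, 0 < C ∧ ∀ (v : R3 → ℝ) (i : Fin 3), SC v → (∀ x, |v x| ≤ 1) →
      ∫ x, |pd i v x| ^ (2 * M / (1 : ℕ) : ℝ) ≤ 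
        ε * (∫ x, |pd i v x| ^ (2 * M / (1 : ℕ) : ℝ))
        + C * ∫ x, |pd i (pd i v) x| ^ (2 * M / (((1 : ℕ) : ℝ) + 1)) := by
  have hM' : (2 : ℝ) ≤ M := by exact_mod_cast haM
  have hM0 : (0 : ℝ) < M := by linarith
  have hq : (0 : ℝ) < 2 * M / (1 : ℕ) - 2 := by
    simp; linarith
  obtain ⟨C, hC, H⟩ := young (w1 := 0) (w2 := 1 / M)
    (w3 := 1 - 1 / M) (by positivity) (by positivity)
    (by rw [sub_nonneg, div_le_one hM0]; linarith) (by ring) hε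
    (by linarith : (0 : ℝ) < (2 * M / (1 : ℕ) - 2) + 1)
  refine ⟨C, hC, ?_⟩
  intro v i hv hv1
  have hb := ibp hv i hq
  rw [sub_add_cancel] at hb
  refine hb.trans ?_
  have i2 := intg_rpow (hv.pd i) (p := 2 * M / ((1 : ℕ) : ℝ)) (by positivity)
  have i3 := intg_rpow ((hv.pd i).pd i) (p := 2 * M / (((1 : ℕ) : ℝ) + 1)) (by positivity)
  rw [← integral_const_mul, ← integral_const_mul,
    ← integral_add (i2.const_mul _) (i3.const_mul _)]
  apply integral_mono
  · apply intg hv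
    · exact continuous_const.mul ((hv.cont.abs.mul ((hv.pd i).pd i).cont.abs).mul
        ((hv.pd i).cont.abs.rpow_const (fun x => Or.inr hq.le)))
    · intro x hx; simp [hx]
  · exact (i2.const_mul _).add (i3.const_mul _)
  · intro x
    have := H 0 (|pd i (pd i v) x| ^ (2 * M / (((1 : ℕ) : ℝ) + 1)))
      (|pd i v x| ^ (2 * M / ((1 : ℕ) : ℝ))) le_rfl (by positivity) (by positivity)
    rw [rpow_cancel (abs_nonneg _) (by push_cast; field_simp; norm_num),
      ← Real.rpow_mul (abs_nonneg _),
      (by push_cast; field_simp : 2 * M / ((1 : ℕ) : ℝ) * (1 - 1 / M) = 2 * M / (1 : ℕ) - 2),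
      Real.rpow_zero, mul_zero, zero_add, one_mul] at this
    refine le_trans ?_ this
    dsimp only
    refine mul_le_mul_of_nonneg_left ?_ (by linarith)
    refine mul_le_mul_of_nonneg_right ?_ (by positivity)
    exact mul_le_of_le_one_left (abs_nonneg _) (hv1 x)

/-- the energies interpolated by the Gagliardo–Nirenberg inequality -/
def EE (M a : ℕ) (u : R3 → ℝ) : ℝ :=
  ∑ β : Fin a → Fin 3, ∫ x, |pdMulti β u x| ^ (2 * M / a : ℝ)

lemma EE_nonneg (M a : ℕ) (u : R3 → ℝ) : 0 ≤ EE M a u :=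
  Finset.sum_nonneg fun β _ => integral_nonneg fun x => by positivity

lemma sum_cons {n : ℕ} (F : (Fin (n + 1) → Fin 3) → ℝ) :
    ∑ β, F β = ∑ γ : Fin n → Fin 3, ∑ i : Fin 3, F (Fin.cons i γ) := by
  rw [← (Fin.consEquiv (fun _ => Fin 3)).sum_comp, Fintype.sum_prod_type, Finset.sum_comm]
  rfl

lemma pdMulti_cons {n : ℕ} (i : Fin 3) (γ : Fin n → Fin 3) (u : R3 → ℝ) :
    pdMulti (Fin.cons i γ : Fin (n + 1) → Fin 3) u = pd i (pdMulti γ u) := by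
  rw [pdMulti_eq, pdMulti_eq, List.ofFn_cons]; rfl

lemma SC.pdMulti {u : R3 → ℝ} (h : SC u) {n : ℕ} (γ : Fin n → Fin 3) : SC (pdMulti γ u) := by
  rw [pdMulti_eq]; exact h.pdL _

lemma sum_diag_le {M a : ℕ} (u : R3 → ℝ) :
    ∑ γ : Fin a → Fin 3, ∑ i : Fin 3,
      ∫ x, |pd i (pd i (pdMulti γ u)) x| ^ (2 * M / ((a + 1 : ℕ) + 1 : ℝ)) ≤ EE M (a + 2) u := by
  unfold EE
  rw [sum_cons, sum_cons]
  apply Finset.sum_le_sum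
  intro γ _
  apply Finset.sum_le_sum
  intro i _
  have := Finset.single_le_sum (f := fun j : Fin 3 => 
    ∫ x, |_root_.pdMulti (Fin.cons j (Fin.cons i γ : Fin (a + 1) → Fin 3) : Fin (a + 2) → Fin 3) u x|
      ^ (2 * M / (a + 2 : ℕ) : ℝ))
    (fun j _ => integral_nonneg fun x => by positivity) (Finset.mem_univ i)
  refine le_trans (le_of_eq ?_) this
  simp only [pdMulti_cons]
  push_cast
  ring_nf

lemma GN1 {M : ℕ} (b : ℕ) (hb : b + 2 ≤ M) :
    ∃ C : ℝ, 0 < C ∧ ∀ u : R3 → ℝ, SC u → (∀ x, |u x| ≤ 1) →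
      EE M (b + 1) u ≤ C * EE M (b + 2) u := by
  induction b with
  | zero =>
    obtain ⟨C, hC, H⟩ := step1 (M := M) hb (ε := 1 / 2) (by norm_num)
    refine ⟨2 * C, by positivity, fun u hu hu1 => ?_⟩
    have h1 : EE M 1 u ≤ 1 / 2 * EE M 1 u + C * EE M 2 u := by
      refine le_trans ?_ (add_le_add_right (mul_le_mul_of_nonneg_left
        (sum_diag_le (M := M) (a := 0) u) hC.le) _)
      unfold EE
      rw [sum_cons, Finset.mul_sum, Finset.mul_sum, ← Finset.sum_add_distrib]
      apply Finset.sum_le_sum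
      intro γ _
      rw [Finset.mul_sum, Finset.mul_sum, ← Finset.sum_add_distrib]
      apply Finset.sum_le_sum
      intro i _
      simp only [pdMulti_cons]
      have : pdMulti γ u = u := by rw [pdMulti_eq]; simp [pdL]
      rw [this]
      exact H u i hu hu1
    linarith
  | succ b ih =>
    obtain ⟨D, hD, HD⟩ := ih (by omega)
    obtain ⟨C, hC, H⟩ := step (M := M) (a := b + 2) (by omega) (by omega)
      (ε := 1 / (2 * (3 * D + 1))) (by positivity)
    refine ⟨2 * C, by positivity, fun u hu hu1 => ?_⟩
    set ε : ℝ := 1 / (2 * (3 * D + 1)) with hε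
    have hεp : 0 < ε := by positivity
    have h1 : EE M (b + 2) u ≤ ε * (3 * EE M (b + 1) u) + ε * EE M (b + 2) u
        + C * EE M (b + 3) u := by
      refine le_trans ?_ (add_le_add_right (mul_le_mul_of_nonneg_left
        (sum_diag_le (M := M) (a := b + 1) u) hC.le) _)
      unfold EE
      rw [sum_cons, Finset.mul_sum, Finset.mul_sum, Finset.mul_sum, Finset.mul_sum,
        ← Finset.sum_add_distrib, ← Finset.sum_add_distrib]
      apply Finset.sum_le_sum
      intro γ _
      have e3 : ε * (3 * ∫ x, |pdMulti γ u x| ^ (2 * M / (b + 1 : ℕ) : ℝ))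
        = ∑ i : Fin 3, ε * ∫ x, |pdMulti γ u x| ^ (2 * M / (b + 1 : ℕ) : ℝ) := by
        simp; ring
      rw [e3, Finset.mul_sum, Finset.mul_sum, ← Finset.sum_add_distrib, ← Finset.sum_add_distrib]
      apply Finset.sum_le_sum
      intro i _
      simp only [pdMulti_cons]
      have := H (pdMulti γ u) i (hu.pdMulti γ)
      have e : ((b + 2 : ℕ) : ℝ) - 1 = (b + 1 : ℕ) := by push_cast; ring
      rw [e] at this
      exact this
    have h2 := HD u hu hu1
    have h3 : ε * (3 * EE M (b + 1) u) ≤ ε * (3 * (D * EE M (b + 2) u)) := by gcongr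
    have h4 : ε * (3 * (D * EE M (b + 2) u)) + ε * EE M (b + 2) u = 1 / 2 * EE M (b + 2) u := by
      rw [hε]; field_simp
    show EE M (b + 2) u ≤ 2 * C * EE M (b + 3) u
    linarith

lemma GN {M : ℕ} (a : ℕ) (ha : 1 ≤ a) (haM : a ≤ M) :
    ∃ C : ℝ, 0 < C ∧ ∀ u : R3 → ℝ, SC u → (∀ x, |u x| ≤ 1) →
      EE M a u ≤ C * EE M M u := by
  induction haM using Nat.decreasingInduction with
  | self => exact ⟨1, one_pos, fun u _ _ => by simp⟩
  | of_succ a haM ih =>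
    obtain ⟨C, hC, H⟩ := ih (by omega)
    obtain ⟨b, rfl⟩ : ∃ b, a = b + 1 := ⟨a - 1, by omega⟩
    obtain ⟨D, hD, HD⟩ := GN1 (M := M) b (by omega)
    refine ⟨D * C, by positivity, fun u hu hu1 => (HD u hu hu1).trans ?_⟩
    rw [mul_assoc]
    exact mul_le_mul_of_nonneg_left (H u hu hu1) hD.le

/-- sum of squared `L²` norms of all derivatives of order `M` -/
def QQ (M : ℕ) (u : R3 → ℝ) : ℝ := ∑ β : Fin M → Fin 3, ∫ x, (pdMulti β u x) ^ 2

lemma QQ_nonneg (M : ℕ) (u : R3 → ℝ) : 0 ≤ QQ M u :=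
  Finset.sum_nonneg fun β _ => integral_nonneg fun x => by positivity

lemma EE_top {M : ℕ} (hM : 1 ≤ M) (u : R3 → ℝ) : EE M M u = QQ M u := by
  have hM0 : (M : ℝ) ≠ 0 := by positivity
  unfold EE QQ
  have : (2 * M / M : ℝ) = 2 := by field_simp
  simp_rw [this, Real.rpow_two, sq_abs]

lemma intg_sq {v : R3 → ℝ} (hv : SC v) : Integrable (fun x => v x ^ 2) := by
  apply intg hv
  · exact hv.cont.pow 2
  · intro x hx; simp [hx]

lemma term0 {M : ℕ} {u v k : R3 → ℝ} (hu : SC u) (hv : SC v) (hk : SC k)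
    (hu1 : ∀ x, |u x| ≤ 1) (δ : Fin M → Fin 3) :
    |∫ x, u x * pdMulti δ v x * k x| ≤ QQ M v + ∫ x, k x ^ 2 := by
  have hv' := hv.pdMulti δ
  refine abs_integral_le_integral_abs.trans ?_
  have h1 : ∫ x, pdMulti δ v x ^ 2 ≤ QQ M v :=
    Finset.single_le_sum (f := fun δ : Fin M → Fin 3 => ∫ x, pdMulti δ v x ^ 2)
      (fun _ _ => integral_nonneg fun x => by positivity) (Finset.mem_univ δ)
  refine le_trans ?_ (add_le_add_left h1 _)
  rw [← integral_add (intg_sq hv') (intg_sq hk)]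
  apply integral_mono
  · apply intg hu
    · exact ((hu.cont.mul hv'.cont).mul hk.cont).abs
    · intro x hx; simp [hx]
  · exact (intg_sq hv').add (intg_sq hk)
  · intro x
    dsimp only
    rw [abs_mul, abs_mul]
    have h2 : |u x| * |pdMulti δ v x| ≤ |pdMulti δ v x| :=
      mul_le_of_le_one_left (abs_nonneg _) (hu1 x)
    have h3 := mul_le_mul_of_nonneg_right h2 (abs_nonneg (k x))
    have h4 := two_mul_le_add_sq |pdMulti δ v x| |k x|
    rw [sq_abs, sq_abs] at h4
    have := abs_nonneg (pdMulti δ v x)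
    have := abs_nonneg (k x)
    nlinarith [mul_nonneg (abs_nonneg (pdMulti δ v x)) (abs_nonneg (k x))]

lemma term1 {M a b : ℕ} (hM : 1 ≤ M) (hab : a + b = M) :
    ∃ C : ℝ, 0 < C ∧ ∀ u v k : R3 → ℝ, SC u → SC v → SC k → (∀ x, |u x| ≤ 1) →
      (∀ x, |v x| ≤ 1) → ∀ (γ : Fin a → Fin 3) (δ : Fin b → Fin 3),
      |∫ x, pdMulti γ u x * pdMulti δ v x * k x| ≤ C * (QQ M u + QQ M v + ∫ x, k x ^ 2) := by
  rcases Nat.eq_zero_or_pos a with rfl | ha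
  · obtain rfl : b = M := by omega
    refine ⟨1, one_pos, fun u v k hu hv hk hu1 hv1 γ δ => ?_⟩
    have : pdMulti γ u = u := by rw [pdMulti_eq]; simp [pdL]
    rw [this]
    have := term0 hu hv hk hu1 δ
    have := QQ_nonneg b u
    linarith
  rcases Nat.eq_zero_or_pos b with rfl | hb
  · obtain rfl : a = M := by omega
    refine ⟨1, one_pos, fun u v k hu hv hk hu1 hv1 γ δ => ?_⟩
    have : pdMulti δ v = v := by rw [pdMulti_eq]; simp [pdL]
    rw [this]
    have h := term0 hv hu hk hv1 γ
    simp_rw [mul_comm (v _)] at h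
    have := QQ_nonneg a v
    linarith
  obtain ⟨C, hC, HC⟩ := GN (M := M) a ha (by omega)
  obtain ⟨D, hD, HD⟩ := GN (M := M) b hb (by omega)
  refine ⟨C + D + 1, by positivity, fun u v k hu hv hk hu1 hv1 γ δ => ?_⟩
  have hu' := hu.pdMulti γ
  have hv' := hv.pdMulti δ
  have ha0 : (0 : ℝ) < a := by exact_mod_cast ha
  have hb0 : (0 : ℝ) < b := by exact_mod_cast hb
  have hM0 : (0 : ℝ) < M := by exact_mod_cast hM
  have hab' : (a : ℝ) + b = M := by exact_mod_cast hab
  have h1 : ∫ x, |pdMulti γ u x| ^ (2 * M / a : ℝ) ≤ EE M a u :=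
    Finset.single_le_sum (f := fun γ : Fin a → Fin 3 => ∫ x, |pdMulti γ u x| ^ (2 * M / a : ℝ))
      (fun _ _ => integral_nonneg fun x => by positivity) (Finset.mem_univ γ)
  have h2 : ∫ x, |pdMulti δ v x| ^ (2 * M / b : ℝ) ≤ EE M b v :=
    Finset.single_le_sum (f := fun γ : Fin b → Fin 3 => ∫ x, |pdMulti γ v x| ^ (2 * M / b : ℝ))
      (fun _ _ => integral_nonneg fun x => by positivity) (Finset.mem_univ δ)
  have h3 := HC u hu hu1
  have h4 := HD v hv hv1
  rw [EE_top hM] at h3 h4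
  have i1 := intg_rpow hu' (p := 2 * M / a) (by positivity)
  have i2 := intg_rpow hv' (p := 2 * M / b) (by positivity)
  have i3 := intg_sq hk
  have key : |∫ x, pdMulti γ u x * pdMulti δ v x * k x| ≤
      (∫ x, |pdMulti γ u x| ^ (2 * M / a : ℝ)) + (∫ x, |pdMulti δ v x| ^ (2 * M / b : ℝ))
        + ∫ x, k x ^ 2 := by
    refine abs_integral_le_integral_abs.trans ?_
    rw [← integral_add i1 i2, ← integral_add (i1.fun_add i2) i3]
    apply integral_mono
    · apply intg hk
      · exact ((hu'.cont.mul hv'.cont).mul hk.cont).abs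
      · intro x hx; simp [hx]
    · exact (i1.fun_add i2).fun_add i3
    · intro x
      dsimp only
      have hy := Real.geom_mean_le_arith_mean2_weighted (w₁ := a / M) (w₂ := b / M)
        (p₁ := |pdMulti γ u x| ^ (2 * M / a : ℝ)) (p₂ := |pdMulti δ v x| ^ (2 * M / b : ℝ))
        (by positivity) (by positivity) (by positivity) (by positivity)
        (by field_simp; linarith)
      rw [← Real.rpow_mul (abs_nonneg _), ← Real.rpow_mul (abs_nonneg _),
        (by field_simp : 2 * M / a * (a / M) = (2 : ℝ)),
        (by field_simp : 2 * M / b * (b / M) = (2 : ℝ)), Real.rpow_two, Real.rpow_two] at hy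
      set X := |pdMulti γ u x| ^ (2 * M / a : ℝ)
      set Y := |pdMulti δ v x| ^ (2 * M / b : ℝ)
      have hX : 0 ≤ X := by positivity
      have hY : 0 ≤ Y := by positivity
      have b1 : (a / M : ℝ) * X ≤ X := mul_le_of_le_one_left hX (by rw [div_le_one hM0]; linarith)
      have b2 : (b / M : ℝ) * Y ≤ Y := mul_le_of_le_one_left hY (by rw [div_le_one hM0]; linarith)
      rw [abs_mul, abs_mul]
      have h4 := two_mul_le_add_sq (|pdMulti γ u x| * |pdMulti δ v x|) |k x|
      rw [mul_pow, sq_abs (k x)] at h4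
      have : 0 ≤ |pdMulti γ u x| * |pdMulti δ v x| * |k x| := by positivity
      linarith
  have q1 := QQ_nonneg M u
  have q2 := QQ_nonneg M v
  have q3 : 0 ≤ ∫ x, k x ^ 2 := integral_nonneg fun x => by positivity
  have : (C + D + 1) * (QQ M u + QQ M v + ∫ x, k x ^ 2) = C * QQ M u + D * QQ M v
    + (∫ x, k x ^ 2) + (C * QQ M v + C * (∫ x, k x ^ 2) + D * QQ M u + D * (∫ x, k x ^ 2)
     + QQ M u + QQ M v) := by ring
  rw [this]
  have : 0 ≤ (C * QQ M v + C * (∫ x, k x ^ 2) + D * QQ M u + D * (∫ x, k x ^ 2)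
     + QQ M u + QQ M v) := by positivity
  linarith

lemma SC.smul {u : R3 → ℝ} (h : SC u) (c : ℝ) : SC (fun x => c * u x) :=
  ⟨contDiff_const.mul h.1, h.2.mul_left⟩

lemma pdMulti_smul {n : ℕ} (γ : Fin n → Fin 3) (c : ℝ) {u : R3 → ℝ} (hu : SC u) :
    pdMulti γ (fun x => c * u x) = fun x => c * pdMulti γ u x := by
  rw [pdMulti_eq, pdMulti_eq, pdL_smul _ _ hu.1]

lemma QQ_smul (M : ℕ) (c : ℝ) {u : R3 → ℝ} (hu : SC u) :
    QQ M (fun x => c * u x) = c ^ 2 * QQ M u := by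
  unfold QQ
  rw [Finset.mul_sum]
  refine Finset.sum_congr rfl fun β _ => ?_
  simp_rw [pdMulti_smul β c hu, mul_pow]
  rw [integral_const_mul]

lemma term2 {M a b : ℕ} (hM : 1 ≤ M) (hab : a + b = M) :
    ∃ C : ℝ, 0 < C ∧ ∀ (A : ℝ) (u v k : R3 → ℝ), 0 < A → SC u → SC v → SC k → (∀ x, |u x| ≤ A) →
      (∀ x, |v x| ≤ A) → ∀ (γ : Fin a → Fin 3) (δ : Fin b → Fin 3),
      |∫ x, pdMulti γ u x * pdMulti δ v x * k x| ≤ C * A * (QQ M u + QQ M v + ∫ x, k x ^ 2) := by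
  obtain ⟨C, hC, H⟩ := term1 hM hab
  refine ⟨C, hC, fun A u v k hA hu hv hk hu1 hv1 γ δ => ?_⟩
  have hb : ∀ w : R3 → ℝ, (∀ x, |w x| ≤ A) → ∀ x, |A⁻¹ * w x| ≤ 1 := by
    intro w hw x
    rw [abs_mul, abs_of_pos (inv_pos.2 hA), inv_mul_le_one₀ hA]
    exact hw x
  have := H _ _ _ (hu.smul A⁻¹) (hv.smul A⁻¹) (hk.smul A⁻¹) (hb u hu1) (hb v hv1) γ δ
  rw [QQ_smul _ _ hu, QQ_smul _ _ hv, pdMulti_smul _ _ hu, pdMulti_smul _ _ hv] at this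
  have e1 : ∀ x, A⁻¹ * pdMulti γ u x * (A⁻¹ * pdMulti δ v x) * (A⁻¹ * k x)
    = A⁻¹ ^ 3 * (pdMulti γ u x * pdMulti δ v x * k x) := fun x => by ring
  simp_rw [e1, mul_pow] at this
  rw [integral_const_mul, integral_const_mul, abs_mul, abs_of_pos (by positivity)] at this
  have h3 := mul_le_mul_of_nonneg_left this (by positivity : 0 ≤ A ^ 3)
  have e2 : ∀ t : ℝ, A ^ 3 * (A⁻¹ ^ 3 * t) = t := fun t => by field_simp
  rw [e2] at h3
  refine h3.trans (le_of_eq ?_)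
  field_simp

/-- list version -/
lemma term3 {M : ℕ} (hM : 1 ≤ M) (S T : List (Fin 3)) (hab : S.length + T.length = M) :
    ∃ C : ℝ, 0 < C ∧ ∀ (A : ℝ) (u v k : R3 → ℝ), 0 < A → SC u → SC v → SC k → (∀ x, |u x| ≤ A) →
      (∀ x, |v x| ≤ A) →
      |∫ x, pdL S u x * pdL T v x * k x| ≤ C * A * (QQ M u + QQ M v + ∫ x, k x ^ 2) := by
  obtain ⟨C, hC, H⟩ := term2 hM hab
  refine ⟨C, hC, fun A u v k hA hu hv hk hu1 hv1 => ?_⟩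
  have := H A u v k hA hu hv hk hu1 hv1 S.get T.get
  simpa only [pdMulti_eq, List.ofFn_get] using this

lemma sup_bound {ι : Type} [Fintype ι] (w : ι → R3 → ℝ) (hw : ∀ i, SC (w i)) (i : ι) (x : R3) :
    |w i x| ≤ ⨆ x, Real.sqrt (∑ i, w i x ^ 2) := by
  have hc : Continuous (fun x => Real.sqrt (∑ i, w i x ^ 2)) :=
    (continuous_finsetSum _ fun i _ => (hw i).cont.pow 2).sqrt
  have hs : HasCompactSupport (fun x => Real.sqrt (∑ i, w i x ^ 2)) := by
    apply HasCompactSupport.intro (K := ⋃ i, tsupport (w i))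
    · exact isCompact_iUnion fun i => (hw i).2
    · intro x hx
      simp only [Set.mem_iUnion, not_exists] at hx
      simp [image_eq_zero_of_notMem_tsupport (hx _)]
  refine le_trans ?_ (le_ciSup (hc.bddAbove_range_of_hasCompactSupport hs) x)
  apply Real.abs_le_sqrt
  exact Finset.single_le_sum (f := fun i => w i x ^ 2) (fun _ _ => by positivity)
    (Finset.mem_univ i)

lemma int_DmSq (m : ℕ) {u : R3 → ℝ} (hu : SC u) : ∫ x, DmSq m u x = QQ m u := by
  unfold DmSq QQ
  rw [integral_finsetSum]
  exact fun β _ => intg_sq (hu.pdMulti β)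

lemma QQ_pd (M : ℕ) {u : R3 → ℝ} (hu : SC u) (j : Fin 3) : QQ M (pd j u) ≤ QQ (M + 1) u := by
  unfold QQ
  rw [sum_cons]
  apply Finset.sum_le_sum
  intro γ _
  have := Finset.single_le_sum (f := fun j : Fin 3 => 
    ∫ x, (pdMulti (Fin.cons j γ : Fin (M + 1) → Fin 3) u x) ^ 2)
    (fun j _ => integral_nonneg fun x => by positivity) (Finset.mem_univ j)
  refine le_trans (le_of_eq ?_) this
  simp only [pdMulti_cons]
  rw [pdMulti_eq, pdMulti_eq, pd_pdL _ _ hu.1]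

lemma list_bound {α : Type} (l : List α) (c : α → ℝ) (B : ℝ) (F : α → R3 → ℝ)
    (hF : ∀ q, Integrable (F q)) (hB : ∀ q ∈ l, |∫ x, F q x| ≤ c q * B) :
    Integrable (fun x => (l.map (fun q => F q x)).sum) ∧
    |∫ x, (l.map (fun q => F q x)).sum| ≤ (l.map c).sum * B := by
  induction l with
  | nil => simp
  | cons q l ih =>
    obtain ⟨h1, h2⟩ := ih fun q hq => hB q (by simp [hq])
    simp only [List.map_cons, List.sum_cons]
    refine ⟨(hF q).add h1, ?_⟩
    rw [integral_add (hF q) h1, add_mul]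
    exact (abs_add_le _ _).trans (add_le_add (hB q (by simp)) h2)

lemma comm_eq (L : List (Fin 3)) (f : R3 → R3) (g : R3 → ℝ)
    (hf : ∀ i, SC (fun y => f y i)) (hg : SC g) (x : R3) :
    pdL L (fun y => ∑ i : Fin 3, f y i * pd i g y) x - ∑ i : Fin 3, f x i * pd i (pdL L g) x
      = ∑ i : Fin 3, ((csp L).map (fun q => pdL q.1 (fun y => f y i) x * pdL q.2 (pd i g) x)).sum := by
  have hc : ∀ i, ContDiff ℝ (⊤ : ℕ∞) (fun y => f y i * pd i g y) :=
    fun i => (hf i).1.mul (hg.pd i).1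
  simp only [Fin.sum_univ_three]
  rw [pdL_add L ((hc 0).add (hc 1)) (hc 2), pdL_add L (hc 0) (hc 1),
    leibniz L (hf 0).1 (hg.pd 0).1, leibniz L (hf 1).1 (hg.pd 1).1, leibniz L (hf 2).1 (hg.pd 2).1,
    pd_pdL _ _ hg.1, pd_pdL _ _ hg.1, pd_pdL _ _ hg.1]
  ring

lemma one_beta {M : ℕ} (hM : 1 ≤ M) (L : List (Fin 3)) (hL : L.length = M + 1) :
    ∃ C : ℝ, 0 < C ∧ ∀ (A N : ℝ) (f : R3 → R3) (g k : R3 → ℝ), 0 < A →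
      (∀ i, SC (fun y => f y i)) → SC g → SC k →
      (∀ i j x, |pd j (fun y => f y i) x| ≤ A) → (∀ i x, |pd i g x| ≤ A) →
      (∀ i j, QQ M (pd j (fun y => f y i)) + QQ M (pd i g) + ∫ x, k x ^ 2 ≤ N) →
      |∫ x, (pdL L (fun y => ∑ i : Fin 3, f y i * pd i g y) x
        - ∑ i : Fin 3, f x i * pd i (pdL L g) x) * k x| ≤ C * (A * N) := by
  have hq : ∀ q : List (Fin 3) × List (Fin 3), ∃ C : ℝ, 0 < C ∧ (q ∈ csp L →
      ∀ (A N : ℝ) (f : R3 → R3) (g k : R3 → ℝ), 0 < A →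
      (∀ i, SC (fun y => f y i)) → SC g → SC k →
      (∀ i j x, |pd j (fun y => f y i) x| ≤ A) → (∀ i x, |pd i g x| ≤ A) →
      (∀ i j, QQ M (pd j (fun y => f y i)) + QQ M (pd i g) + ∫ x, k x ^ 2 ≤ N) →
      ∀ i, |∫ x, pdL q.1 (fun y => f y i) x * pdL q.2 (pd i g) x * k x| ≤ C * (A * N)) := by
    intro q
    by_cases hmem : q ∈ csp L
    · obtain ⟨S, T⟩ := q
      obtain ⟨hne, hlen⟩ := csp_len L _ hmem
      dsimp only at hne hlen ⊢
      obtain ⟨S', j, rfl⟩ : ∃ S' j, S = S' ++ [j] :=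
        ⟨_, _, (List.dropLast_append_getLast hne).symm⟩
      simp only [List.length_append, List.length_singleton] at hlen
      obtain ⟨C, hC, H⟩ := term3 hM S' T (by omega)
      refine ⟨C, hC, fun _ A N f g k hA hf hg hk hfA hgA hN i => ?_⟩
      rw [pdL_snoc]
      refine (H A _ _ k hA ((hf i).pd j) (hg.pd i) hk (hfA i j) (hgA i)).trans ?_
      rw [mul_assoc]
      have := hN i j
      gcongr
    · exact ⟨1, one_pos, fun h => absurd h hmem⟩
  choose c hc H using hq
  have hsum : 0 ≤ ((csp L).map c).sum := by
    apply List.sum_nonneg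
    intro t ht
    obtain ⟨q, _, rfl⟩ := List.mem_map.1 ht
    exact (hc q).le
  refine ⟨3 * ((csp L).map c).sum + 1, by positivity,
    fun A N f g k hA hf hg hk hfA hgA hN => ?_⟩
  have hN0 : 0 ≤ N := by
    refine le_trans ?_ (hN 0 0)
    have := QQ_nonneg M (pd 0 (fun y => f y 0))
    have := QQ_nonneg M (pd 0 g)
    have : 0 ≤ ∫ x, k x ^ 2 := integral_nonneg fun x => by positivity
    linarith
  have hi : ∀ i : Fin 3, _ := fun i => list_bound (csp L) c (A * N)
    (fun q x => pdL q.1 (fun y => f y i) x * pdL q.2 (pd i g) x * k x)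
    (fun q => intg hk ((((hf i).pdL q.1).cont.mul ((hg.pd i).pdL q.2).cont).mul hk.cont)
      (fun x hx => by simp [hx]))
    (fun q hq => H q hq A N f g k hA hf hg hk hfA hgA hN i)
  have e : ∀ x, (pdL L (fun y => ∑ i : Fin 3, f y i * pd i g y) x
        - ∑ i : Fin 3, f x i * pd i (pdL L g) x) * k x
      = ∑ i : Fin 3, ((csp L).map
          (fun q => pdL q.1 (fun y => f y i) x * pdL q.2 (pd i g) x * k x)).sum := by
    intro x
    rw [comm_eq L f g hf hg x, Finset.sum_mul]
    refine Finset.sum_congr rfl fun i _ => ?_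
    rw [List.sum_map_mul_right]
  simp_rw [e]
  rw [integral_finsetSum _ fun i _ => (hi i).1]
  refine (Finset.abs_sum_le_sum_abs _ _).trans ?_
  refine (Finset.sum_le_sum fun i _ => (hi i).2).trans ?_
  simp only [Finset.sum_const, Finset.card_univ, Fintype.card_fin, nsmul_eq_mul]
  have : 0 ≤ A * N := by positivity
  push_cast
  nlinarith

/-- the Kato–Ponce commutator estimate
`|∫ [∇^m, f·∇]g ⬝ ∇^m k| ≤ C (‖∇f‖_∞ + ‖∇g‖_∞)(‖∇^m f‖_{L²}² + ‖∇^m g‖_{L²}² + ‖∇^m k‖_{L²}²)`. -/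
theorem stmt_12 (m : ℕ) (hm : 2 ≤ m) :
    ∃ C : ℝ, 0 < C ∧
      ∀ (f : R3 → R3) (g k : R3 → ℝ),
        ContDiff ℝ (⊤ : ℕ∞) f → HasCompactSupport f →
        ContDiff ℝ (⊤ : ℕ∞) g → HasCompactSupport g →
        ContDiff ℝ (⊤ : ℕ∞) k → HasCompactSupport k →
        |∑ β : Fin m → Fin 3,
            ∫ x : R3,
              (pdMulti β (fun y => ∑ i : Fin 3, f y i * pd i g y) x
                - ∑ i : Fin 3, f x i * pd i (pdMulti β g) x) * pdMulti β k x|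
          ≤ C * (gradSupV f + gradSupS g)
              * ((∫ x : R3, ∑ i : Fin 3, DmSq m (fun y => f y i) x)
                  + (∫ x : R3, DmSq m g x) + ∫ x : R3, DmSq m k x) := by
  obtain ⟨M, rfl⟩ : ∃ M, m = M + 1 := ⟨m - 1, by omega⟩
  have hM : 1 ≤ M := by omega
  have hβ : ∀ β : Fin (M + 1) → Fin 3, _ := fun β => one_beta hM (List.ofFn β) (by simp)
  choose c hc H using hβ
  refine ⟨∑ β, c β, Finset.sum_pos (fun β _ => hc β) Finset.univ_nonempty, ?_⟩
  intro f g k hf hfs hg hgs hk hks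
  have hfi : ∀ i, SC (fun y => f y i) := fun i =>
    ⟨(contDiff_pi.1 hf) i, hfs.comp_left (g := fun v : R3 => v i) rfl⟩
  have hG : SC g := ⟨hg, hgs⟩
  have hK : SC k := ⟨hk, hks⟩
  have hfA : ∀ i j x, |pd j (fun y => f y i) x| ≤ gradSupV f := by
    intro i j x
    have := sup_bound (fun (q : Fin 3 × Fin 3) => pd q.2 (fun y => f y q.1))
      (fun q => (hfi q.1).pd q.2) (i, j) x
    simp only [Fintype.sum_prod_type] at this
    exact this
  have hgA : ∀ i x, |pd i g x| ≤ gradSupS g := fun i x =>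
    sup_bound (fun i => pd i g) (fun i => hG.pd i) i x
  have hf0 : 0 ≤ gradSupV f := (abs_nonneg _).trans (hfA 0 0 0)
  have hg0 : 0 ≤ gradSupS g := (abs_nonneg _).trans (hgA 0 0)
  have eN : ∫ x : R3, ∑ i : Fin 3, DmSq (M + 1) (fun y => f y i) x
      = ∑ i : Fin 3, QQ (M + 1) (fun y => f y i) := by
    rw [integral_finsetSum]
    · exact Finset.sum_congr rfl fun i _ => int_DmSq _ (hfi i)
    · intro i _
      exact integrable_finsetSum _ fun β _ => intg_sq ((hfi i).pdMulti β)
  rw [eN, int_DmSq _ hG, int_DmSq _ hK]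
  set N := ∑ i : Fin 3, QQ (M + 1) (fun y => f y i) + QQ (M + 1) g + QQ (M + 1) k with hNdef
  have hN0 : 0 ≤ N := add_nonneg (add_nonneg (Finset.sum_nonneg fun i _ => QQ_nonneg _ _)
    (QQ_nonneg _ _)) (QQ_nonneg _ _)
  set s := gradSupV f + gradSupS g with hs
  have hc0 : 0 < ∑ β, c β := Finset.sum_pos (fun β _ => hc β) Finset.univ_nonempty
  have main : ∀ A, s < A → |∑ β : Fin (M + 1) → Fin 3,
            ∫ x : R3,
              (pdMulti β (fun y => ∑ i : Fin 3, f y i * pd i g y) x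
                - ∑ i : Fin 3, f x i * pd i (pdMulti β g) x) * pdMulti β k x|
          ≤ (∑ β, c β) * A * N := by
    intro A hA
    refine (Finset.abs_sum_le_sum_abs _ _).trans ?_
    rw [mul_assoc, Finset.sum_mul]
    apply Finset.sum_le_sum
    intro β _
    have := H β A N f g (pdMulti β k) (by linarith) hfi hG (hK.pdMulti β)
      (fun i j x => (hfA i j x).trans (by linarith)) (fun i x => (hgA i x).trans (by linarith)) ?_
    · simpa only [pdMulti_eq] using this
    · intro i j
      rw [hNdef]
      refine add_le_add (add_le_add ?_ (QQ_pd M hG i)) ?_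
      · refine (QQ_pd M (hfi i) j).trans ?_
        exact Finset.single_le_sum (f := fun i => QQ (M + 1) (fun y => f y i))
          (fun _ _ => QQ_nonneg _ _) (Finset.mem_univ i)
      · exact Finset.single_le_sum (f := fun β : Fin (M + 1) → Fin 3 => ∫ x, pdMulti β k x ^ 2)
          (fun _ _ => integral_nonneg fun x => by positivity) (Finset.mem_univ β)
  have ht : Filter.Tendsto (fun A => (∑ β, c β) * A * N) (nhdsWithin s (Set.Ioi s))
      (nhds ((∑ β, c β) * s * N)) := by
    have : Continuous (fun A => (∑ β, c β) * A * N) := by fun_prop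
    exact (this.tendsto s).mono_left nhdsWithin_le_nhds
  refine ge_of_tendsto ht ?_
  filter_upwards [self_mem_nhdsWithin] with A hA
  exact main A hA
end
end
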